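/- arXiv:2604.01358 — 7 statements merged into one kernel-verified Lean document; each statement's English description precedes it below -/
import Mathlib

section
/- The number of conjugacy classes of H_β equals qⁿ + (q−1)·q^{n−m}, where m = rank(Bᵀ − B). -/
open Matrix

/-- The generalized Heisenberg group `H_β` attached to the bilinear form
`β(u,w) = uᵀ B w` on `V = 𝔽ⁿ` with Gram matrix `B`.  Its carrier is `V × 𝔽`;
an element is a pair `⟨v, r⟩` with `v ∈ V` and `r ∈ 𝔽`. -/
@[ext]
structure Hei (𝔽 : Type) [Field 𝔽] (n : ℕ) (B : Matrix (Fin n) (Fin n) 𝔽) where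
  v : Fin n → 𝔽
  t : 𝔽

namespace Hei

variable {𝔽 : Type} [Field 𝔽] {n : ℕ} {B : Matrix (Fin n) (Fin n) 𝔽}

/-- Multiplication `(v,r)·(w,s) = (v+w, r+s+β(v,w))`. -/
instance : Mul (Hei 𝔽 n B) := ⟨fun p q => ⟨p.v + q.v, p.t + q.t + p.v ⬝ᵥ B *ᵥ q.v⟩⟩
instance : One (Hei 𝔽 n B) := ⟨⟨0, 0⟩⟩
instance : Inv (Hei 𝔽 n B) := ⟨fun p => ⟨-p.v, p.v ⬝ᵥ B *ᵥ p.v - p.t⟩⟩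

lemma mul_def (p q : Hei 𝔽 n B) :
    p * q = ⟨p.v + q.v, p.t + q.t + p.v ⬝ᵥ B *ᵥ q.v⟩ := rfl
lemma one_def : (1 : Hei 𝔽 n B) = ⟨0, 0⟩ := rfl
lemma inv_def (p : Hei 𝔽 n B) : p⁻¹ = ⟨-p.v, p.v ⬝ᵥ B *ᵥ p.v - p.t⟩ := rfl

instance : Group (Hei 𝔽 n B) where
  mul := (· * ·)
  one := 1
  inv := (·⁻¹)
  mul_assoc p q r := by
    simp only [mul_def, mk.injEq, mulVec_add, dotProduct_add, add_dotProduct]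
    exact ⟨add_assoc _ _ _, by ring⟩
  one_mul p := by simp [mul_def, one_def]
  mul_one p := by simp [mul_def, one_def]
  inv_mul_cancel p := by
    simp only [mul_def, inv_def, one_def, mk.injEq, neg_dotProduct]
    exact ⟨neg_add_cancel _, by ring⟩

end Hei


namespace Hei

variable {𝔽 : Type} [Field 𝔽] {n : ℕ} {B : Matrix (Fin n) (Fin n) 𝔽}

lemma isConj_iff_aux (v w : Fin n → 𝔽) (s t : 𝔽) :
    IsConj (⟨v, s⟩ : Hei 𝔽 n B) ⟨w, t⟩ ↔
      v = w ∧ ∃ g : Fin n → 𝔽, s = t + g ⬝ᵥ (Bᵀ - B) *ᵥ v := by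
  have key : ∀ g : Fin n → 𝔽, g ⬝ᵥ (Bᵀ - B) *ᵥ v = v ⬝ᵥ B *ᵥ g - g ⬝ᵥ B *ᵥ v := by
    intro g
    rw [sub_mulVec, dotProduct_sub, mulVec_transpose, dotProduct_comm g, ← dotProduct_mulVec]
  constructor
  · intro h
    obtain ⟨c, hc⟩ := h
    have hc' : (c : Hei 𝔽 n B) * ⟨v, s⟩ = ⟨w, t⟩ * c := hc
    simp only [mul_def, mk.injEq] at hc'
    obtain ⟨h1, h2⟩ := hc'
    have hvw : v = w := by
      rw [add_comm] at h1
      exact add_right_cancel h1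
    subst hvw
    refine ⟨rfl, (c : Hei 𝔽 n B).v, ?_⟩
    rw [key]
    linear_combination h2
  · rintro ⟨rfl, g, hg⟩
    rw [key] at hg
    refine ⟨toUnits (⟨g, 0⟩ : Hei 𝔽 n B), ?_⟩
    change (⟨g, 0⟩ : Hei 𝔽 n B) * ⟨v, s⟩ = ⟨v, t⟩ * ⟨g, 0⟩
    simp only [mul_def, mk.injEq]
    exact ⟨add_comm _ _, by linear_combination hg⟩

/-- Representatives of the conjugacy classes. -/
def rep (B : Matrix (Fin n) (Fin n) 𝔽) :
    (Fin n → 𝔽) ⊕ (LinearMap.ker (Bᵀ - B).mulVecLin × 𝔽ˣ) → ConjClasses (Hei 𝔽 n B)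
  | Sum.inl v => ConjClasses.mk ⟨v, 0⟩
  | Sum.inr p => ConjClasses.mk ⟨p.1.1, (p.2 : 𝔽)⟩

lemma rep_bijective (B : Matrix (Fin n) (Fin n) 𝔽) : Function.Bijective (rep B) := by
  constructor
  · rintro (v | ⟨⟨v, hv⟩, a⟩) (w | ⟨⟨w, hw⟩, b⟩) h <;>
      simp only [rep, ConjClasses.mk_eq_mk_iff_isConj, isConj_iff_aux] at h <;>
      obtain ⟨rfl, g, hg⟩ := h
    · rfl
    · simp only [LinearMap.mem_ker, mulVecLin_apply] at hw
      simp [hw] at hg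
      exact absurd hg.symm b.ne_zero
    · simp only [LinearMap.mem_ker, mulVecLin_apply] at hv
      simp [hv] at hg
    · simp only [LinearMap.mem_ker, mulVecLin_apply] at hv
      simp only [hv, dotProduct_zero, add_zero] at hg
      have : a = b := Units.ext hg
      subst this
      rfl
  · intro c
    obtain ⟨⟨v, t⟩, rfl⟩ := ConjClasses.exists_rep c
    by_cases hv : (Bᵀ - B) *ᵥ v = 0
    · by_cases ht : t = 0
      · exact ⟨Sum.inl v, by subst ht; rfl⟩
      · exact ⟨Sum.inr (⟨v, LinearMap.mem_ker.mpr hv⟩, Units.mk0 t ht), rfl⟩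
    · refine ⟨Sum.inl v, ?_⟩
      simp only [rep, ConjClasses.mk_eq_mk_iff_isConj, isConj_iff_aux]
      obtain ⟨i, hi⟩ := Function.ne_iff.mp hv
      simp only [Pi.zero_apply] at hi
      refine ⟨trivial, Pi.single i (-t / ((Bᵀ - B) *ᵥ v) i), ?_⟩
      rw [single_dotProduct, div_mul_cancel₀ _ hi]
      ring

end Hei

/-- Over the finite field `𝔽 = 𝔽_q` with `q` a power of an odd prime, the number of
conjugacy classes of `H_β` equals `qⁿ + (q−1)·q^{n−m}`, where `m = rank(Bᵀ − B)`. -/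
theorem stmt_6 (q p k : ℕ) (hp : p.Prime) (hodd : Odd p) (hk : 0 < k) (hq : q = p ^ k)
    (𝔽 : Type) [Field 𝔽] [Fintype 𝔽] (hcard : Fintype.card 𝔽 = q)
    (n : ℕ) (hn : 0 < n) (B : Matrix (Fin n) (Fin n) 𝔽) :
    Nat.card (ConjClasses (Hei 𝔽 n B)) =
      q ^ n + (q - 1) * q ^ (n - (Bᵀ - B).rank) := by
  classical
  rw [← Nat.card_congr (Equiv.ofBijective _ (Hei.rep_bijective B)), Nat.card_sum, Nat.card_prod]
  have h1 : Nat.card (Fin n → 𝔽) = q ^ n := by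
    rw [Nat.card_eq_fintype_card]; simp [hcard]
  have h2 : Nat.card 𝔽ˣ = q - 1 := by
    rw [Nat.card_eq_fintype_card, Fintype.card_units, hcard]
  have h3 : Nat.card (LinearMap.ker (Bᵀ - B).mulVecLin) = q ^ (n - (Bᵀ - B).rank) := by
    rw [Module.natCard_eq_pow_finrank (K := 𝔽), Nat.card_eq_fintype_card, hcard]
    congr 1
    have := LinearMap.finrank_range_add_finrank_ker (Bᵀ - B).mulVecLin
    rw [Module.finrank_fin_fun] at this
    unfold Matrix.rank
    omega
  rw [h1, h2, h3, mul_comm (q - 1)]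
end

section
/- The number of isomorphism classes of irreducible complex representations of H_β (equivalently, the number of irreducible complex characters of H_β) equals qⁿ + (q−1)·q^{n−m}, where m = rank(Bᵀ − B). -/
open Matrix

open CategoryTheory

namespace IrrCount
variable {G : Type} [Group G] [Fintype G]

lemma exists_simple (S : Type) [AddCommGroup S] [Module ℂ S] [Module (MonoidAlgebra ℂ G) S]
    [IsScalarTower ℂ (MonoidAlgebra ℂ G) S] [FiniteDimensional ℂ S]
    [IsSimpleModule (MonoidAlgebra ℂ G) S] :
    ∃ V : FDRep ℂ G, Simple V ∧ ∀ g, V.character g =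
      LinearMap.trace ℂ S (Algebra.lsmul ℂ ℂ S (MonoidAlgebra.of ℂ G g)) := by
  let σ : Representation ℂ G S := Representation.ofModule' S
  have hσ : ∀ g, σ g = Algebra.lsmul ℂ ℂ S (MonoidAlgebra.of ℂ G g) := fun g => rfl
  have halg : σ.asAlgebraHom = Algebra.lsmul ℂ ℂ S := by
    simp [σ, Representation.ofModule', Representation.asAlgebraHom]
  let e : σ.asModule ≃ₗ[MonoidAlgebra ℂ G] S :=
    { σ.asModuleEquiv.toAddEquiv with
      map_smul' := fun r x => by
        change σ.asAlgebraHom r _ = _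
        rw [halg]; rfl }
  have hirr : σ.IsIrreducible := by
    rw [Representation.irreducible_iff_isSimpleModule_asModule]
    exact IsSimpleModule.congr e
  refine ⟨FDRep.of σ, ?_, fun g => rfl⟩
  rw [FDRep.simple_iff_char_is_norm_one]
  have := invertibleOfNonzero (NeZero.ne (Nat.card G : ℂ))
  have h := Representation.card_inv_mul_sum_char_mul_char_eq_finrank σ σ
  rw [Representation.IsIrreducible.finrank_intertwiningMap_self] at h
  have h0 : (Nat.card G : ℂ) ≠ 0 := NeZero.ne _
  rw [Nat.cast_one, inv_mul_eq_one₀ h0] at h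
  exact h.symm

lemma eq_zero_of_orthogonal (f : G → ℂ) (hf : ∀ g h, f (h * g * h⁻¹) = f g)
    (h0 : ∀ V : FDRep ℂ G, Simple V → ∑ g, f g * V.character g = 0) : f = 0 := by
  classical
  let a : MonoidAlgebra ℂ G := ∑ g, MonoidAlgebra.single g (f g)
  have hcen : ∀ x : MonoidAlgebra ℂ G, a * x = x * a := by
    intro x
    induction x using MonoidAlgebra.induction_linear with
    | zero => simp
    | add x y hx hy => rw [mul_add, add_mul, hx, hy]
    | single h c =>
      simp only [a, Finset.sum_mul, Finset.mul_sum, MonoidAlgebra.single_mul_single]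
      refine Fintype.sum_equiv (MulAut.conj h⁻¹).toEquiv _ _ fun g => ?_
      have := hf g h⁻¹
      simp only [inv_inv, mul_assoc] at this
      simp [this, mul_assoc, mul_comm]
  have hS : ∀ S : Submodule (MonoidAlgebra ℂ G) (MonoidAlgebra ℂ G),
      IsSimpleModule (MonoidAlgebra ℂ G) S → ∀ x ∈ S, a * x = 0 := by
    intro S _ x hx
    have : FiniteDimensional ℂ (MonoidAlgebra ℂ G) := inferInstance
    have : FiniteDimensional ℂ S := 
      FiniteDimensional.of_injective (S.subtype.restrictScalars ℂ) Subtype.val_injective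
    obtain ⟨V, hV, hch⟩ := exists_simple (G := G) S
    have h1 := h0 V hV
    let φ : Module.End (MonoidAlgebra ℂ G) S :=
      { toFun := fun y => a • y
        map_add' := fun y z => smul_add _ _ _
        map_smul' := fun r y => by simp [smul_smul, hcen] }
    obtain ⟨c, hc⟩ := (IsSimpleModule.algebraMap_end_bijective_of_isAlgClosed
      (A := MonoidAlgebra ℂ G) (V := S) ℂ).2 φ
    have hc' : ∀ y : S, a • y = c • y := fun y => by
      have := congrArg (fun ψ : Module.End (MonoidAlgebra ℂ G) S => ψ y) hc
      simpa [φ] using this.symm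
    have h2 : ∑ g, f g * V.character g = LinearMap.trace ℂ S (Algebra.lsmul ℂ ℂ S a) := by
      simp only [a, map_sum, hch]
      refine Finset.sum_congr rfl fun g _ => ?_
      have : MonoidAlgebra.single g (f g) = f g • MonoidAlgebra.of ℂ G g := by simp
      rw [this, map_smul, map_smul, smul_eq_mul]
    have h3 : Algebra.lsmul ℂ ℂ S a = c • LinearMap.id := by
      ext1 y; exact hc' y
    have : Nontrivial S := IsSimpleModule.nontrivial (MonoidAlgebra ℂ G) S
    have hd : (Module.finrank ℂ S : ℂ) ≠ 0 := by
      exact_mod_cast (Module.finrank_pos (R := ℂ) (M := S)).ne'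
    rw [h2, h3, map_smul, LinearMap.trace_id, smul_eq_mul] at h1
    have hc0 : c = 0 := (mul_eq_zero.1 h1).resolve_right hd
    have := hc' ⟨x, hx⟩
    rw [hc0, zero_smul] at this
    exact congrArg Subtype.val this
  let K : Submodule (MonoidAlgebra ℂ G) (MonoidAlgebra ℂ G) :=
    LinearMap.ker (LinearMap.toSpanSingleton (MonoidAlgebra ℂ G) (MonoidAlgebra ℂ G) a)
  have hK : K = ⊤ := by
    rw [eq_top_iff, ← IsSemisimpleModule.sSup_simples_eq_top, sSup_le_iff]
    intro S hS' x hx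
    have := hS S hS' x hx
    rw [hcen] at this
    simpa [K] using this
  have ha : a = 0 := by
    have : (1 : MonoidAlgebra ℂ G) ∈ K := by simp [hK]
    simpa [K] using this
  funext g
  have := congrArg (fun b : MonoidAlgebra ℂ G => b.coeff g) ha
  simpa [a, Finsupp.single_apply] using this

abbrev Irr (G : Type) [Group G] : Type :=
  {f : G → ℂ // ∃ V : FDRep ℂ G, Simple V ∧ f = V.character}

lemma linInd : LinearIndependent ℂ (fun χ : Irr G => χ.1) := by
  classical
  have := invertibleOfNonzero (NeZero.ne (Nat.card G : ℂ))
  have horth : ∀ χ ψ : Irr G, (Nat.card G : ℂ)⁻¹ * ∑ g : G, χ.1 g * ψ.1 g⁻¹ =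
      if χ = ψ then 1 else 0 := by
    rintro ⟨_, V, hV, rfl⟩ ⟨_, W, hW, rfl⟩
    rw [FDRep.char_orthonormal V W]
    by_cases hVW : Nonempty (V ≅ W)
    · have : V.character = W.character := FDRep.char_iso hVW.some
      simp [hVW, this]
    · have : V.character ≠ W.character := by
        intro h
        have h1 := FDRep.char_orthonormal V W
        have h2 := FDRep.char_orthonormal V V
        rw [← h, h2] at h1
        simp [hVW, Nonempty.intro (Iso.refl V)] at h1
      simp [hVW, this]
  rw [linearIndependent_iff']
  intro s c hc ψ hψ
  have h1 : ∀ g, ∑ χ ∈ s, c χ * χ.1 g = 0 := fun g => by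
    simpa using congrFun hc g
  have h2 : ∑ χ ∈ s, c χ * ((Nat.card G : ℂ)⁻¹ * ∑ g : G, χ.1 g * ψ.1 g⁻¹) = 0 := by
    calc _ = (Nat.card G : ℂ)⁻¹ * ∑ g : G, (∑ χ ∈ s, c χ * χ.1 g) * ψ.1 g⁻¹ := by
          simp only [Finset.mul_sum, Finset.sum_mul]
          rw [Finset.sum_comm]
          refine Finset.sum_congr rfl fun _ _ => Finset.sum_congr rfl fun _ _ => by ring
      _ = 0 := by simp [h1]
  simp only [horth] at h2
  simpa [hψ] using h2

theorem card_irr : Nat.card (Irr G) = Nat.card (ConjClasses G) := by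
  classical
  have : Finite (ConjClasses G) := inferInstance
  have : Fintype (ConjClasses G) := Fintype.ofFinite _
  let L : (ConjClasses G → ℂ) →ₗ[ℂ] (G → ℂ) := LinearMap.funLeft ℂ ℂ ConjClasses.mk
  have hL : Function.Injective L :=
    LinearMap.funLeft_injective_of_surjective _ _ _ ConjClasses.mk_surjective
  have hcl : ∀ φ g h, L φ (h * g * h⁻¹) = L φ g := by
    intro φ g h
    change φ (ConjClasses.mk _) = φ (ConjClasses.mk _)
    congr 1
    rw [ConjClasses.mk_eq_mk_iff_isConj, isConj_comm, isConj_iff]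
    exact ⟨h, rfl⟩
  have hfin : Finite (Irr G) := linInd.finite
  have : Fintype (Irr G) := Fintype.ofFinite _
  apply le_antisymm
  · have hex : ∀ χ : Irr G, ∃ φ : ConjClasses G → ℂ, L φ = χ.1 := by
      rintro ⟨_, V, hV, rfl⟩
      refine ⟨Quotient.lift V.character ?_, rfl⟩
      intro x y hxy
      obtain ⟨c, hc⟩ := isConj_iff.1 (show IsConj x y from hxy)
      rw [← hc, FDRep.char_conj]
    choose F hF using hex
    have hli : LinearIndependent ℂ F := by
      apply LinearIndependent.of_comp L
      have : L ∘ F = fun χ : Irr G => χ.1 := funext hF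
      rw [this]; exact linInd
    have := hli.fintype_card_le_finrank
    simpa [Nat.card_eq_fintype_card] using this
  · let T : (ConjClasses G → ℂ) →ₗ[ℂ] (Irr G → ℂ) :=
      { toFun := fun φ χ => ∑ g, L φ g * χ.1 g
        map_add' := fun φ ψ => by
          ext χ; simp [add_mul, Finset.sum_add_distrib]
        map_smul' := fun c φ => by
          ext χ; simp [Finset.mul_sum, mul_assoc] }
    have hT : Function.Injective T := by
      rw [← LinearMap.ker_eq_bot, LinearMap.ker_eq_bot']
      intro φ hφ
      apply hL
      rw [map_zero]
      refine eq_zero_of_orthogonal _ (hcl φ) fun V hV => ?_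
      exact congrFun hφ ⟨V.character, V, hV, rfl⟩
    have := LinearMap.finrank_le_finrank_of_injective hT
    simpa [Nat.card_eq_fintype_card] using this

end IrrCount

namespace Hei
variable {𝔽 : Type} [Field 𝔽] [Fintype 𝔽] {n : ℕ} {B : Matrix (Fin n) (Fin n) 𝔽}

def equivProd : Hei 𝔽 n B ≃ (Fin n → 𝔽) × 𝔽 where
  toFun p := (p.v, p.t)
  invFun p := ⟨p.1, p.2⟩
  left_inv _ := rfl
  right_inv _ := rfl

lemma conj_iff (x y : Hei 𝔽 n B) : IsConj x y ↔
    x.v = y.v ∧ ∃ w : Fin n → 𝔽, y.t = x.t - w ⬝ᵥ (Bᵀ - B) *ᵥ x.v := by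
  have key : ∀ c : Hei 𝔽 n B, c * x = y * c ↔
      x.v = y.v ∧ y.t = x.t - c.v ⬝ᵥ (Bᵀ - B) *ᵥ x.v := by
    intro c
    have hT : c.v ⬝ᵥ Bᵀ *ᵥ x.v = x.v ⬝ᵥ B *ᵥ c.v := by
      rw [mulVec_transpose, dotProduct_comm, ← dotProduct_mulVec]
    simp only [mul_def, Hei.mk.injEq, sub_mulVec, dotProduct_sub, hT]
    rw [add_comm c.v, add_left_inj]
    refine and_congr_right fun h => ?_
    rw [← h]
    constructor <;> intro h <;> linear_combination -h
  simp only [isConj_iff, mul_inv_eq_iff_eq_mul, key]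
  constructor
  · rintro ⟨c, h1, h2⟩; exact ⟨h1, c.v, h2⟩
  · rintro ⟨h1, w, h2⟩; exact ⟨⟨w, 0⟩, h1, h2⟩

lemma card_conj : Nat.card (ConjClasses (Hei 𝔽 n B)) =
    Fintype.card 𝔽 ^ n + (Fintype.card 𝔽 - 1) * Fintype.card 𝔽 ^ (n - (Bᵀ - B).rank) := by
  classical
  set D := Bᵀ - B with hD
  let K := LinearMap.ker D.mulVecLin
  have hKmem : ∀ v, v ∈ K ↔ D *ᵥ v = 0 := fun v => by simp [K]
  let Φ : {v : Fin n → 𝔽 // ¬ v ∈ K} ⊕ (K × 𝔽) → ConjClasses (Hei 𝔽 n B) :=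
    Sum.elim (fun v => ConjClasses.mk ⟨v.1, 0⟩) (fun p => ConjClasses.mk ⟨p.1.1, p.2⟩)
  have hΦ : Function.Bijective Φ := by
    constructor
    · rintro (⟨v, hv⟩ | ⟨⟨v, hv⟩, r⟩) (⟨w, hw⟩ | ⟨⟨w, hw⟩, s⟩) h <;>
      · simp only [Φ, Sum.elim_inl, Sum.elim_inr, ConjClasses.mk_eq_mk_iff_isConj, conj_iff] at h
        obtain ⟨rfl, u, hu⟩ := h
        first
          | rfl
          | exact absurd hv hw
          | exact absurd hw hv
          | (rw [← hD, (hKmem _).1 hv] at hu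
             simp at hu
             subst hu; rfl)
    · intro c
      obtain ⟨⟨v, r⟩, rfl⟩ := ConjClasses.mk_surjective c
      by_cases hv : v ∈ K
      · exact ⟨Sum.inr ⟨⟨v, hv⟩, r⟩, rfl⟩
      · refine ⟨Sum.inl ⟨v, hv⟩, ?_⟩
        simp only [Φ, Sum.elim_inl, ConjClasses.mk_eq_mk_iff_isConj, conj_iff]
        refine ⟨trivial, ?_⟩
        rw [hKmem] at hv
        obtain ⟨i, hi⟩ := Function.ne_iff.1 hv
        refine ⟨Pi.single i (-r / (D *ᵥ v) i), ?_⟩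
        rw [single_dotProduct, div_mul_cancel₀ _ hi]; ring
  have hrank := D.mulVecLin.finrank_range_add_finrank_ker
  rw [Module.finrank_fin_fun] at hrank
  have hfk : Module.finrank 𝔽 K = n - D.rank := by
    have : D.rank = Module.finrank 𝔽 (LinearMap.range D.mulVecLin) := rfl
    change _ + Module.finrank 𝔽 K = n at hrank
    omega
  have hK : Fintype.card K = Fintype.card 𝔽 ^ (n - D.rank) := by
    rw [← hfk, Module.card_eq_pow_finrank (K := 𝔽)]
  have hcompl : Fintype.card {v : Fin n → 𝔽 // ¬ v ∈ K} + Fintype.card K = Fintype.card 𝔽 ^ n := by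
    have h1 := Fintype.card_subtype_compl (fun v => v ∈ K)
    have h2 := Fintype.card_subtype_le (fun v => v ∈ K)
    have h3 : Fintype.card (Fin n → 𝔽) = Fintype.card 𝔽 ^ n := by simp
    have h4 : Fintype.card K = Fintype.card {v // v ∈ K} := rfl
    omega
  rw [← Nat.card_congr (Equiv.ofBijective Φ hΦ), Nat.card_eq_fintype_card, Fintype.card_sum,
    Fintype.card_prod, ← hK, ← hcompl]
  obtain ⟨m, hm⟩ : ∃ m, Fintype.card 𝔽 = m + 1 :=
    ⟨_, (Nat.succ_pred_eq_of_pos Fintype.card_pos).symm⟩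
  rw [hm, Nat.add_sub_cancel]; ring

end Hei


/-- Over the finite field `𝔽 = 𝔽_q` with `q` a power of an odd prime, the number of
isomorphism classes of irreducible complex representations of `H_β` (equivalently, the
number of irreducible complex characters of `H_β`) equals `qⁿ + (q−1)·q^{n−m}`, where
`m = rank(Bᵀ − B)`.  (Over `ℂ`, isomorphism classes of representations of a finite group
correspond bijectively to their characters, so we count irreducible characters.) -/
theorem stmt_7 (q p k : ℕ) (hp : p.Prime) (hodd : Odd p) (hk : 0 < k) (hq : q = p ^ k)
    (𝔽 : Type) [Field 𝔽] [Fintype 𝔽] (hcard : Fintype.card 𝔽 = q)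
    (n : ℕ) (hn : 0 < n) (B : Matrix (Fin n) (Fin n) 𝔽) :
    Nat.card {f : Hei 𝔽 n B → ℂ //
        ∃ V : FDRep ℂ (Hei 𝔽 n B), Simple V ∧ f = V.character} =
      q ^ n + (q - 1) * q ^ (n - (Bᵀ - B).rank) := by
  classical
  have : Fintype (Hei 𝔽 n B) := Fintype.ofEquiv _ Hei.equivProd.symm
  rw [← hcard, ← Hei.card_conj]
  exact IrrCount.card_irr
end

section
/- For all v,w ∈ 𝔽ⁿ, all r,s,t ∈ 𝔽 and all u ∈ 𝔽ⁿ, one has the trace identity tr( λ(w,s) · M(v,r)⁻¹ · X(u,t) · M(v,r) ) = tr( λ(w + s(Bᵀ−B)v, s) · X(u,t) ). Here, for the coadjoint action of the matrix realization of H_β, this says that the element M(v,r) transforms the linear functional corresponding to (w,s) into the functional corresponding to (w + s(Bᵀ−B)v, s). -/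
open Matrix

/-- Extension of a vector `v ∈ 𝔽ⁿ` to a function on `ℕ` (by zero), used to address
entries of matrices by natural-number indices. -/
def pad {𝔽 : Type} [Field 𝔽] {n : ℕ} (v : Fin n → 𝔽) : ℕ → 𝔽 :=
  fun j => if h : j < n then v ⟨j, h⟩ else 0

/-- The matrix realization `M(v,r)` of an element `(v,r)` of the generalized Heisenberg
group: the `(n+2)×(n+2)` matrix with `1`s on the diagonal, first row `(1, v, r)`,
last column `(r, Bᵀv, 1)` and zeros elsewhere (0-based indexing). -/
def Mmat {𝔽 : Type} [Field 𝔽] {n : ℕ} (B : Matrix (Fin n) (Fin n) 𝔽)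
    (v : Fin n → 𝔽) (r : 𝔽) : Matrix (Fin (n + 2)) (Fin (n + 2)) 𝔽 :=
  fun i j =>
    if (i : ℕ) = (j : ℕ) then 1
    else if (i : ℕ) = 0 ∧ (j : ℕ) = n + 1 then r
    else if (i : ℕ) = 0 then pad v ((j : ℕ) - 1)
    else if (j : ℕ) = n + 1 then pad (Bᵀ *ᵥ v) ((i : ℕ) - 1)
    else 0

/-- The Lie-algebra element `X(u,t)`: the `(n+2)×(n+2)` matrix with first row
`(0, u, t)`, last column `(t, Bᵀu, 0)` and zeros elsewhere (0-based indexing). -/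
def Xmat {𝔽 : Type} [Field 𝔽] {n : ℕ} (B : Matrix (Fin n) (Fin n) 𝔽)
    (u : Fin n → 𝔽) (t : 𝔽) : Matrix (Fin (n + 2)) (Fin (n + 2)) 𝔽 :=
  fun i j =>
    if (i : ℕ) = 0 ∧ (j : ℕ) = n + 1 then t
    else if (i : ℕ) = 0 ∧ (j : ℕ) ≠ 0 then pad u ((j : ℕ) - 1)
    else if (j : ℕ) = n + 1 ∧ (i : ℕ) ≠ 0 then pad (Bᵀ *ᵥ u) ((i : ℕ) - 1)
    else 0

/-- The matrix `λ(w,s)` representing a linear functional on the Lie algebra `𝔥_β` via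
the trace form: the `(n+2)×(n+2)` matrix whose first column is `(0, w, s)` and whose
other entries vanish (0-based indexing). -/
def lmat {𝔽 : Type} [Field 𝔽] {n : ℕ} (w : Fin n → 𝔽) (s : 𝔽) :
    Matrix (Fin (n + 2)) (Fin (n + 2)) 𝔽 :=
  fun i j =>
    if (j : ℕ) = 0 then
      (if (i : ℕ) = n + 1 then s else if (i : ℕ) ≠ 0 then pad w ((i : ℕ) - 1) else 0)
    else 0

theorem pad_val {𝔽 : Type} [Field 𝔽] {n : ℕ} (v : Fin n → 𝔽) (k : Fin n) :
    pad v (k : ℕ) = v k := by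
  simp [pad]

theorem pad_n {𝔽 : Type} [Field 𝔽] {n : ℕ} (v : Fin n → 𝔽) : pad v n = 0 := by
  simp [pad]

theorem fin_tri {n : ℕ} (i : Fin (n + 2)) :
    i = 0 ∨ (∃ k : Fin n, i = k.castSucc.succ) ∨ i = (Fin.last n).succ := by
  refine Fin.cases (Or.inl rfl) (fun j => Or.inr ?_) i
  refine Fin.lastCases (Or.inr rfl) (fun k => Or.inl ⟨k, rfl⟩) j

theorem Mmat_det {𝔽 : Type} [Field 𝔽] {n : ℕ} (B : Matrix (Fin n) (Fin n) 𝔽)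
    (v : Fin n → 𝔽) (r : 𝔽) : (Mmat B v r).det = 1 := by
  rw [Matrix.det_of_upperTriangular]
  · simp [Mmat]
  · intro i j hij
    have h : (j : ℕ) < (i : ℕ) := hij
    have := i.isLt
    unfold Mmat
    rw [if_neg (by omega), if_neg (by omega), if_neg (by omega), if_neg (by omega)]

theorem X_mul_M {𝔽 : Type} [Field 𝔽] {n : ℕ} (B : Matrix (Fin n) (Fin n) 𝔽)
    (v u : Fin n → 𝔽) (r t : 𝔽) :
    Xmat B u t * Mmat B v r =
      Mmat B v r * Xmat B u (t + u ⬝ᵥ (Bᵀ *ᵥ v) - v ⬝ᵥ (Bᵀ *ᵥ u)) := by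
  ext i j
  have hk : ∀ k : Fin n, (k : ℕ) ≠ n := fun k => k.isLt.ne
  have hk' : ∀ k : Fin n, n ≠ (k : ℕ) := fun k => k.isLt.ne'
  rcases fin_tri i with rfl | ⟨a, rfl⟩ | rfl <;> rcases fin_tri j with rfl | ⟨b, rfl⟩ | rfl <;>
    rw [Matrix.mul_apply, Matrix.mul_apply, Fin.sum_univ_succ, Fin.sum_univ_castSucc,
      Fin.sum_univ_succ, Fin.sum_univ_castSucc] <;>
    simp [Mmat, Xmat, pad_val, pad_n, hk, hk', dotProduct, Fin.val_inj] <;> try ring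

theorem tr_lX {𝔽 : Type} [Field 𝔽] {n : ℕ} (B : Matrix (Fin n) (Fin n) 𝔽)
    (w u : Fin n → 𝔽) (s t : 𝔽) :
    Matrix.trace (lmat w s * Xmat B u t) = w ⬝ᵥ u + s * t := by
  have hk : ∀ k : Fin n, (k : ℕ) ≠ n := fun k => k.isLt.ne
  rw [Matrix.trace_mul_comm, Matrix.trace, Fin.sum_univ_succ]
  simp only [Matrix.diag, Matrix.mul_apply]
  rw [Fin.sum_univ_succ, Fin.sum_univ_castSucc]
  simp [lmat, Xmat, pad_val, hk, dotProduct, mul_comm]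

/-- For all `v, w ∈ 𝔽ⁿ`, all `r, s, t ∈ 𝔽` and all `u ∈ 𝔽ⁿ`, one has the trace identity
`tr(λ(w,s)·M(v,r)⁻¹·X(u,t)·M(v,r)) = tr(λ(w + s(Bᵀ−B)v, s)·X(u,t))`: the element
`M(v,r)` transforms the functional corresponding to `(w,s)` into the functional
corresponding to `(w + s(Bᵀ−B)v, s)` under the coadjoint action. -/
theorem stmt_9 (𝔽 : Type) [Field 𝔽] (hchar : ringChar 𝔽 ≠ 2)
    (n : ℕ) (hn : 0 < n) (B : Matrix (Fin n) (Fin n) 𝔽)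
    (v w u : Fin n → 𝔽) (r s t : 𝔽) :
    Matrix.trace (lmat w s * (Mmat B v r)⁻¹ * Xmat B u t * Mmat B v r) =
      Matrix.trace (lmat (w + s • ((Bᵀ - B) *ᵥ v)) s * Xmat B u t) := by
  have hu : IsUnit (Mmat B v r).det := by rw [Mmat_det]; exact isUnit_one
  rw [Matrix.mul_assoc, X_mul_M, Matrix.mul_assoc, Matrix.nonsing_inv_mul_cancel_left _ _ hu,
    tr_lX, tr_lX]
  have h1 : v ⬝ᵥ (Bᵀ *ᵥ u) = (B *ᵥ v) ⬝ᵥ u := by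
    rw [Matrix.dotProduct_mulVec, Matrix.vecMul_transpose]
  rw [h1, dotProduct_comm u, add_dotProduct, smul_dotProduct, Matrix.sub_mulVec, sub_dotProduct,
    smul_eq_mul]
  ring
end

section
/- For the action of H_β on 𝔽_qⁿ × 𝔽_q given by ((v,r),(w,s)) ↦ (w + s(Bᵀ−B)v, s): the points (w,0) form exactly qⁿ one-point orbits; every orbit of a point (w,s) with s ≠ 0 has exactly q^m elements, where m = rank(Bᵀ−B), and the number of such orbits is exactly (q−1)·q^{n−m}. -/
open Matrix

/-- For the coadjoint action of `H_β` on `𝔽_qⁿ × 𝔽_q` given by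
`((v,r),(w,s)) ↦ (w + s(Bᵀ−B)v, s)`: the points `(w,0)` form exactly `qⁿ` one-point
orbits; every orbit of a point `(w,s)` with `s ≠ 0` has exactly `q^m` elements, where
`m = rank(Bᵀ−B)`, and the number of such orbits is exactly `(q−1)·q^{n−m}`. -/
theorem stmt_11 (q p k : ℕ) (hp : p.Prime) (hodd : Odd p) (hk : 0 < k) (hq : q = p ^ k)
    (𝔽 : Type) [Field 𝔽] [Fintype 𝔽] (hcard : Fintype.card 𝔽 = q)
    (n : ℕ) (hn : 0 < n) (B : Matrix (Fin n) (Fin n) 𝔽)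
    (m : ℕ) (hm : m = (Bᵀ - B).rank)
    (act : Hei 𝔽 n B → ((Fin n → 𝔽) × 𝔽) → ((Fin n → 𝔽) × 𝔽))
    (hact : ∀ g x, act g x = (x.1 + x.2 • ((Bᵀ - B) *ᵥ g.v), x.2)) :
    (∀ w : Fin n → 𝔽,
      {y : (Fin n → 𝔽) × 𝔽 | ∃ g : Hei 𝔽 n B, act g (w, 0) = y} = {(w, (0 : 𝔽))}) ∧
    Nat.card {S : Set ((Fin n → 𝔽) × 𝔽) //
        ∃ w : Fin n → 𝔽, S = {y | ∃ g : Hei 𝔽 n B, act g (w, 0) = y}} = q ^ n ∧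
    (∀ (w : Fin n → 𝔽) (s : 𝔽), s ≠ 0 →
      Nat.card {y : (Fin n → 𝔽) × 𝔽 // ∃ g : Hei 𝔽 n B, act g (w, s) = y} = q ^ m) ∧
    Nat.card {S : Set ((Fin n → 𝔽) × 𝔽) //
        ∃ (w : Fin n → 𝔽) (s : 𝔽), s ≠ 0 ∧
          S = {y | ∃ g : Hei 𝔽 n B, act g (w, s) = y}} = (q - 1) * q ^ (n - m) := by
  classical
  have hfr : Module.finrank 𝔽 (LinearMap.range (Bᵀ - B).mulVecLin) = m := hm.symm
  set R := LinearMap.range (Bᵀ - B).mulVecLin with hR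
  have hcard' : Nat.card 𝔽 = q := by rw [Nat.card_eq_fintype_card, hcard]
  have h0 : ∀ w : Fin n → 𝔽,
      {y : (Fin n → 𝔽) × 𝔽 | ∃ g : Hei 𝔽 n B, act g (w, 0) = y} = {(w, (0 : 𝔽))} := by
    intro w
    ext y
    simp only [hact, Set.mem_ofPred_eq, Set.mem_singleton_iff, zero_smul, add_zero]
    exact ⟨fun ⟨_, h⟩ => h.symm, fun h => ⟨1, h.symm⟩⟩
  have h1 : ∀ (w : Fin n → 𝔽) (s : 𝔽), s ≠ 0 → ∀ y : (Fin n → 𝔽) × 𝔽,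
      (∃ g : Hei 𝔽 n B, act g (w, s) = y) ↔ (y.1 - w ∈ R ∧ y.2 = s) := by
    intro w s hs y
    constructor
    · rintro ⟨g, rfl⟩
      rw [hact]
      refine ⟨?_, rfl⟩
      simp only [add_sub_cancel_left]
      exact R.smul_mem s ⟨g.v, rfl⟩
    · rintro ⟨⟨v, hv⟩, h2⟩
      refine ⟨⟨s⁻¹ • v, 0⟩, ?_⟩
      rw [hact]
      rw [mulVecLin_apply] at hv
      apply Prod.ext
      · simp only [mulVec_smul, smul_smul, mul_inv_cancel₀ hs, one_smul, hv]
        abel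
      · exact h2.symm
  have hRc : Nat.card R = q ^ m := by
    rw [Module.natCard_eq_pow_finrank (K := 𝔽), hcard', hfr]
  refine ⟨h0, ?_, ?_, ?_⟩
  · have e : (Fin n → 𝔽) ≃ {S : Set ((Fin n → 𝔽) × 𝔽) //
        ∃ w : Fin n → 𝔽, S = {y | ∃ g : Hei 𝔽 n B, act g (w, 0) = y}} := by
      refine Equiv.ofBijective (fun w => ⟨{y | ∃ g : Hei 𝔽 n B, act g (w, 0) = y}, w, rfl⟩) ⟨?_, ?_⟩
      · intro w w' h
        have h' := congrArg Subtype.val h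
        simp only [h0] at h'
        exact congrArg Prod.fst (Set.singleton_injective h')
      · rintro ⟨S, w, rfl⟩
        exact ⟨w, rfl⟩
    rw [← Nat.card_congr e, Nat.card_fun, hcard', Nat.card_eq_fintype_card, Fintype.card_fin]
  · intro w s hs
    have e : R ≃ {y : (Fin n → 𝔽) × 𝔽 // ∃ g : Hei 𝔽 n B, act g (w, s) = y} :=
      { toFun := fun r => ⟨(w + r.1, s), (h1 w s hs _).2 ⟨by simp, rfl⟩⟩
        invFun := fun y => ⟨y.1.1 - w, ((h1 w s hs _).1 y.2).1⟩
        left_inv := fun r => by simp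
        right_inv := fun y => by
          apply Subtype.ext
          apply Prod.ext
          · simp
          · exact (((h1 w s hs _).1 y.2).2).symm }
    rw [← Nat.card_congr e, hRc]
  · let f : 𝔽ˣ × (Fin n → 𝔽) → {S : Set ((Fin n → 𝔽) × 𝔽) //
        ∃ (w : Fin n → 𝔽) (s : 𝔽), s ≠ 0 ∧
          S = {y | ∃ g : Hei 𝔽 n B, act g (w, s) = y}} :=
      fun x => ⟨_, x.2, x.1, x.1.ne_zero, rfl⟩
    have hf : ∀ a b, f a = f b ↔ a.1 = b.1 ∧ a.2 - b.2 ∈ R := by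
      rintro ⟨s, w⟩ ⟨s', w'⟩
      constructor
      · intro h
        have h' := congrArg Subtype.val h
        have h2 : ((w, (s : 𝔽)) : (Fin n → 𝔽) × 𝔽) ∈ (f (s, w)).1 :=
          (h1 w s s.ne_zero _).2 ⟨by simp, rfl⟩
        rw [h'] at h2
        have h3 := (h1 w' s' s'.ne_zero _).1 h2
        exact ⟨Units.ext h3.2, h3.1⟩
      · rintro ⟨h, h2⟩
        dsimp only at h h2
        subst h
        apply Subtype.ext
        ext y
        refine (h1 w s s.ne_zero y).trans (Iff.trans ?_ (h1 w' s s.ne_zero y).symm)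
        refine and_congr_left fun _ => ?_
        have : y.1 - w' = (y.1 - w) + (w - w') := by abel
        rw [this]
        exact (R.add_mem_iff_left h2).symm
    have e : 𝔽ˣ × ((Fin n → 𝔽) ⧸ R) ≃ {S : Set ((Fin n → 𝔽) × 𝔽) //
        ∃ (w : Fin n → 𝔽) (s : 𝔽), s ≠ 0 ∧
          S = {y | ∃ g : Hei 𝔽 n B, act g (w, s) = y}} := by
      refine Equiv.ofBijective (fun x => f (x.1, Quotient.out x.2)) ⟨?_, ?_⟩
      · rintro ⟨s, w⟩ ⟨s', w'⟩ h
        obtain ⟨h2, h3⟩ := (hf _ _).1 h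
        refine Prod.ext h2 ?_
        have := (Submodule.Quotient.eq R).2 h3
        simpa [Submodule.Quotient.mk] using this
      · rintro ⟨S, w, s, hs, rfl⟩
        refine ⟨(Units.mk0 s hs, Submodule.Quotient.mk w), ?_⟩
        have : f (Units.mk0 s hs, w) = ⟨_, w, s, hs, rfl⟩ := rfl
        rw [← this]
        refine (hf _ _).2 ⟨rfl, (Submodule.Quotient.eq R).1 ?_⟩
        exact Quotient.out_eq _
    have hfq : Module.finrank 𝔽 ((Fin n → 𝔽) ⧸ R) = n - m := by
      rw [Submodule.finrank_quotient, hfr, Module.finrank_fin_fun]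
    rw [← Nat.card_congr e, Nat.card_prod, Module.natCard_eq_pow_finrank (K := 𝔽) (V := (Fin n → 𝔽) ⧸ R), hcard', hfq,
      Nat.card_eq_fintype_card, Fintype.card_units, hcard]
end

section
/- For every homomorphism ψ : A → ℂˣ and every irreducible complex character η of B^ψ, the function ψ₀η₀ : A·B^ψ → ℂ defined by (ψ₀η₀)(ab) = ψ(a)η(b) (for a ∈ A, b ∈ B^ψ) is an irreducible complex character of the subgroup A·B^ψ, and the induced class function χ_{ψ,η} = Ind_{A·B^ψ}^𝒢(ψ₀η₀) is an irreducible complex character of 𝒢. -/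
open CategoryTheory Classical

attribute [local instance] Classical.propDecidable

theorem aux_trace_pi {ι : Type} [Fintype ι] {W : Type} [AddCommGroup W] [Module ℂ W]
    [FiniteDimensional ℂ W] (T : (ι → W) →ₗ[ℂ] (ι → W)) :
    LinearMap.trace ℂ (ι → W) T =
      ∑ i, LinearMap.trace ℂ W (LinearMap.proj i ∘ₗ T ∘ₗ LinearMap.single ℂ (fun _ => W) i) := by
  have h : T = ∑ i, (T ∘ₗ LinearMap.single ℂ (fun _ => W) i) ∘ₗ LinearMap.proj i := by
    refine LinearMap.ext fun v => ?_
    rw [LinearMap.sum_apply]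
    simp only [LinearMap.comp_apply, LinearMap.proj_apply, LinearMap.coe_single]
    rw [← map_sum, Finset.univ_sum_single]
  conv_lhs => rw [h, map_sum]
  refine Finset.sum_congr rfl fun i _ => ?_
  rw [LinearMap.trace_comp_comm']

/-- Character of the (co)induced representation. -/
theorem aux_ind_char {G : Type} [Group G] [Fintype G] (H : Subgroup G) {W : Type}
    [AddCommGroup W] [Module ℂ W] [FiniteDimensional ℂ W] (σ : Representation ℂ H W) (g : G) :
    LinearMap.trace ℂ _ (Representation.coind H.subtype σ g) =
      (Nat.card H : ℂ)⁻¹ * ∑ x : G,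
        if hx : x⁻¹ * g * x ∈ H then LinearMap.trace ℂ W (σ ⟨x⁻¹ * g * x, hx⟩) else 0 := by
  let P : (G → W) →ₗ[ℂ] (G → W) :=
    (Nat.card H : ℂ)⁻¹ • ∑ h : H, LinearMap.pi fun x => σ h⁻¹ ∘ₗ LinearMap.proj ((h : G) * x)
  have hP : ∀ v x, P v x = (Nat.card H : ℂ)⁻¹ • ∑ h : H, σ h⁻¹ (v ((h : G) * x)) := by
    intro v x
    simp [P, LinearMap.sum_apply, Finset.sum_apply]
  have hcard : (Nat.card H : ℂ) ≠ 0 := by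
    exact_mod_cast (Nat.card_pos (α := H)).ne'
  have hmem : ∀ v, P v ∈ Representation.coindV H.subtype σ := by
    intro v k x
    rw [hP, hP, map_smul, map_sum]
    congr 1
    refine Fintype.sum_equiv (Equiv.mulRight k) _ _ fun h => ?_
    simp [← Module.End.mul_apply, ← map_mul, mul_assoc]
  have hfix : ∀ v ∈ Representation.coindV H.subtype σ, P v = v := by
    intro v hv
    funext x
    rw [hP]
    have : ∀ h : H, σ h⁻¹ (v ((h : G) * x)) = v x := by
      intro h
      have := hv h x
      rw [Subgroup.subtype_apply] at this
      rw [this, ← Module.End.mul_apply, ← map_mul]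
      simp
    rw [Finset.sum_congr rfl fun h _ => this h, Finset.sum_const, Finset.card_univ,
      ← Nat.card_eq_fintype_card, ← Nat.cast_smul_eq_nsmul ℂ, smul_smul, inv_mul_cancel₀ hcard,
      one_smul]
  let π : (G → W) →ₗ[ℂ] Representation.coindV H.subtype σ := P.codRestrict _ hmem
  let ι := (Representation.coindV H.subtype σ).subtype
  have hπι : Representation.coind H.subtype σ g =
      (Representation.coind H.subtype σ g ∘ₗ π) ∘ₗ ι := by
    refine LinearMap.ext fun v => ?_
    have : π (ι v) = v := Subtype.ext (hfix v v.2)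
    simp [this]
  rw [hπι, LinearMap.trace_comp_comm', aux_trace_pi, Finset.mul_sum]
  refine Fintype.sum_equiv (Equiv.inv G) _ _ fun x => ?_
  have key : LinearMap.proj x ∘ₗ (ι ∘ₗ Representation.coind H.subtype σ g ∘ₗ π) ∘ₗ
      LinearMap.single ℂ (fun _ => W) x = (Nat.card H : ℂ)⁻¹ •
        if hx : x * g * x⁻¹ ∈ H then σ ⟨x * g * x⁻¹, hx⟩ else 0 := by
    refine LinearMap.ext fun w => ?_
    have e1 : (LinearMap.proj x ∘ₗ (ι ∘ₗ Representation.coind H.subtype σ g ∘ₗ π) ∘ₗ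
      LinearMap.single ℂ (fun _ => W) x) w = P (Pi.single x w) (x * g) := rfl
    rw [e1, hP, LinearMap.smul_apply]
    congr 1
    split_ifs with hx
    · rw [Finset.sum_eq_single (⟨x * g * x⁻¹, hx⟩⁻¹ : H)]
      · simp [mul_assoc]
      · intro h _ hne
        rw [Pi.single_eq_of_ne, map_zero]
        intro e
        apply hne
        apply Subtype.ext
        simp only [Subgroup.coe_inv]
        rw [eq_inv_iff_mul_eq_one, ← mul_assoc, e, mul_inv_cancel]
      · simp
    · rw [LinearMap.zero_apply]
      refine Finset.sum_eq_zero fun h _ => ?_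
      rw [Pi.single_eq_of_ne, map_zero]
      intro e
      apply hx
      have : x * g * x⁻¹ = (h : G)⁻¹ := by
        rw [eq_inv_iff_mul_eq_one, ← inv_eq_iff_mul_eq_one, eq_comm, eq_inv_iff_mul_eq_one,
          ← mul_assoc, e, mul_inv_cancel]
      rw [this]
      exact H.inv_mem h.2
  rw [key, map_smul, smul_eq_mul]
  congr 1
  simp only [Equiv.inv_apply, inv_inv]
  split_ifs <;> simp

/-- Mackey's little-group method, existence part.  Let `𝒢 = A ⋊ B` be a finite group
with `A` abelian and normal, `A ∩ B = {1}` and `AB = 𝒢`.  Let `ψ : A → ℂˣ` be a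
homomorphism, `Bψ = B^ψ ≤ 𝒢` its stabilizer in `B` (where `b` acts by
`(b.ψ)(a) = ψ(b⁻¹ab)`), `H = A·B^ψ`, and let `η` be an irreducible complex character of
`B^ψ`.  Then the function `ψ₀η₀ : H → ℂ`, `(ψ₀η₀)(ab) = ψ(a)η(b)`, is an irreducible
complex character of `H`, and the induced class function
`χ_{ψ,η} = Ind_H^𝒢(ψ₀η₀)`, `g ↦ |H|⁻¹ ∑_{x ∈ 𝒢} (ψ₀η₀)˙(x⁻¹gx)`, is an irreducible
complex character of `𝒢`. -/
theorem stmt_14 (𝒢 : Type) [Group 𝒢] [Fintype 𝒢] (A B : Subgroup 𝒢)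
    (habel : ∀ a ∈ A, ∀ a' ∈ A, a * a' = a' * a) (hnorm : A.Normal)
    (hint : A ⊓ B = ⊥) (hgen : ∀ g : 𝒢, ∃ a ∈ A, ∃ b ∈ B, g = a * b)
    (ψ : ↥A →* ℂˣ)
    (Bψ : Subgroup 𝒢)
    (hBψ : ∀ g : 𝒢, g ∈ Bψ ↔ g ∈ B ∧ ∀ (a : 𝒢) (ha : a ∈ A),
      ψ ⟨g⁻¹ * a * g, by simpa using hnorm.conj_mem a ha g⁻¹⟩ = ψ ⟨a, ha⟩)
    (H : Subgroup 𝒢)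
    (hH : ∀ g : 𝒢, g ∈ H ↔ ∃ a ∈ A, ∃ b ∈ Bψ, g = a * b)
    (η : ↥Bψ → ℂ)
    (hη : ∃ W : FDRep ℂ ↥Bψ, Simple W ∧ η = W.character)
    (f : ↥H → ℂ)
    (hf : ∀ (a b : 𝒢) (ha : a ∈ A) (hb : b ∈ Bψ),
      f ⟨a * b, (hH _).2 ⟨a, ha, b, hb, rfl⟩⟩ = (ψ ⟨a, ha⟩ : ℂ) * η ⟨b, hb⟩) :
    (∃ V : FDRep ℂ ↥H, Simple V ∧ f = V.character) ∧
    (∃ V : FDRep ℂ 𝒢, Simple V ∧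
      (fun g : 𝒢 => (Nat.card ↥H : ℂ)⁻¹ * ∑ x : 𝒢,
        if hx : x⁻¹ * g * x ∈ H then f ⟨x⁻¹ * g * x, hx⟩ else 0) = V.character) := by
  obtain ⟨W, hW, rfl⟩ := hη
  have hdisj : ∀ g, g ∈ A → g ∈ Bψ → g = 1 := by
    intro g h1 h2
    have : g ∈ A ⊓ B := ⟨h1, ((hBψ g).1 h2).1⟩
    rwa [hint, Subgroup.mem_bot] at this
  have huniq : ∀ a b a' b', a ∈ A → b ∈ Bψ → a' ∈ A → b' ∈ Bψ → a * b = a' * b' →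
      a = a' ∧ b = b' := by
    intro a b a' b' ha hb ha' hb' e
    have e2 : a'⁻¹ * a = b' * b⁻¹ := by
      rw [eq_mul_inv_iff_mul_eq, mul_assoc, e, inv_mul_cancel_left]
    have h1 := hdisj (a'⁻¹ * a) (A.mul_mem (A.inv_mem ha') ha)
      (e2 ▸ Bψ.mul_mem hb' (Bψ.inv_mem hb))
    have h2 := h1
    rw [e2] at h2
    exact ⟨(inv_mul_eq_one.1 h1).symm, (mul_inv_eq_one.1 h2).symm⟩
  -- invariance of ψ under Bψ
  have hψinv : ∀ b ∈ Bψ, ∀ (a : 𝒢) (ha : a ∈ A) (h' : b * a * b⁻¹ ∈ A),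
      ψ ⟨b * a * b⁻¹, h'⟩ = ψ ⟨a, ha⟩ := by
    intro b hb a ha h'
    have := ((hBψ b⁻¹).1 (Bψ.inv_mem hb)).2 a ha
    simpa using this
  have hconjA : ∀ g a, a ∈ A → g * a * g⁻¹ ∈ A := fun g a ha => hnorm.conj_mem a ha g
  choose p hp q hq hpq using fun h : H => (hH h).1 h.2
  have hpq' : ∀ a b (ha : a ∈ A) (hb : b ∈ Bψ) (h : a * b ∈ H),
      p ⟨a * b, h⟩ = a ∧ q ⟨a * b, h⟩ = b := fun a b ha hb h =>
    huniq _ _ _ _ (hp _) (hq _) ha hb (hpq ⟨a * b, h⟩).symm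
  have hmulp : ∀ h k : H, p (h * k) = p h * (q h * p k * (q h)⁻¹) ∧ q (h * k) = q h * q k := by
    intro h k
    refine huniq _ _ _ _ (hp _) (hq _) (A.mul_mem (hp _) (hconjA _ _ (hp _)))
      (Bψ.mul_mem (hq _) (hq _)) ?_
    rw [← hpq (h * k), Subgroup.coe_mul, hpq h, hpq k]
    simp only [← hpq]
    rw [show (h : 𝒢) * k = (p h * q h) * (p k * q k) by rw [← hpq h, ← hpq k]]
    group
  have hψp : ∀ h k : H, ψ ⟨p (h * k), hp _⟩ = ψ ⟨p h, hp _⟩ * ψ ⟨p k, hp _⟩ := by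
    intro h k
    rw [← hψinv (q h) (hq h) (p k) (hp k) (hconjA _ _ (hp _)), ← map_mul]
    congr 1
    exact Subtype.ext (hmulp h k).1
  have hq1 : q 1 = 1 := by
    have := (hmulp 1 1).2
    simpa using this
  have hp1 : p 1 = 1 := by
    have := hpq 1
    simpa [hq1] using this.symm
  let σ : Representation ℂ H W :=
    { toFun := fun h => ((ψ ⟨p h, hp h⟩ : ℂˣ) : ℂ) • W.ρ ⟨q h, hq h⟩
      map_one' := by
        have e1 : (⟨p 1, hp 1⟩ : A) = 1 := Subtype.ext hp1
        have e2 : (⟨q 1, hq 1⟩ : Bψ) = 1 := Subtype.ext hq1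
        rw [e1, e2, map_one, map_one, Units.val_one, one_smul]
      map_mul' := by
        intro h k
        have e2 : (⟨q (h * k), hq _⟩ : Bψ) = ⟨q h, hq h⟩ * ⟨q k, hq k⟩ :=
          Subtype.ext (hmulp h k).2
        rw [hψp, e2, map_mul, Units.val_mul, smul_mul_smul_comm] }
  have hfσ : ∀ h : H, f h = LinearMap.trace ℂ W (σ h) := by
    intro h
    have h1 := hf (p h) (q h) (hp h) (hq h)
    have h2 : (⟨p h * q h, (hH _).2 ⟨_, hp h, _, hq h, rfl⟩⟩ : H) = h := Subtype.ext (hpq h).symm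
    rw [h2] at h1
    rw [h1]
    simp [σ, FDRep.character]
  have hfV : f = (FDRep.of σ).character := by
    funext h
    exact hfσ h
  have hWnorm := (FDRep.simple_iff_char_is_norm_one W).1 hW
  have hf' : ∀ h : H, f h = (ψ ⟨p h, hp h⟩ : ℂ) * W.character ⟨q h, hq h⟩ := by
    intro h
    rw [hfσ]
    simp [σ, FDRep.character]
  have hψpinv : ∀ h : H, (ψ ⟨p h, hp h⟩ : ℂ) * (ψ ⟨p h⁻¹, hp _⟩ : ℂ) = 1 := by
    intro h
    rw [← Units.val_mul, ← hψp]
    have e1 : (⟨p (h * h⁻¹), hp _⟩ : A) = 1 := Subtype.ext (by rw [mul_inv_cancel]; exact hp1)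
    rw [e1, map_one, Units.val_one]
  have hqinv : ∀ h : H, (⟨q h⁻¹, hq _⟩ : Bψ) = ⟨q h, hq h⟩⁻¹ := by
    intro h
    apply Subtype.ext
    rw [Subgroup.coe_inv, eq_inv_iff_mul_eq_one, ← (hmulp _ _).2, inv_mul_cancel, hq1]
  let e : H ≃ A × Bψ :=
    { toFun := fun h => (⟨p h, hp h⟩, ⟨q h, hq h⟩)
      invFun := fun x => ⟨x.1 * x.2, (hH _).2 ⟨_, x.1.2, _, x.2.2, rfl⟩⟩
      left_inv := fun h => Subtype.ext (hpq h).symm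
      right_inv := by
        rintro ⟨⟨a, ha⟩, ⟨b, hb⟩⟩
        have := hpq' a b ha hb ((hH _).2 ⟨_, ha, _, hb, rfl⟩)
        exact Prod.ext (Subtype.ext this.1) (Subtype.ext this.2) }
  have hfnorm : ∑ h : H, f h * f h⁻¹ = Nat.card H := by
    have h1 : ∀ h : H, f h * f h⁻¹ =
        (fun x : A × Bψ => W.character x.2 * W.character x.2⁻¹) (e h) := by
      intro h
      rw [hf' h, hf' h⁻¹, hqinv, mul_mul_mul_comm, hψpinv, one_mul]
      rfl
    rw [Fintype.sum_equiv e _ (fun x : A × Bψ => W.character x.2 * W.character x.2⁻¹) h1, Fintype.sum_prod_type]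
    dsimp only
    rw [hWnorm, Finset.sum_const, Finset.card_univ,
      Nat.card_congr e, Nat.card_prod, ← Nat.card_eq_fintype_card, nsmul_eq_mul,
      Nat.cast_mul]
  refine ⟨⟨FDRep.of σ, ?_, hfV⟩, ?_⟩
  · rw [FDRep.simple_iff_char_is_norm_one, ← hfV]
    exact hfnorm
  -- the extension of f by zero
  let F : 𝒢 → ℂ := fun g => if hg : g ∈ H then f ⟨g, hg⟩ else 0
  have hFin : ∀ g (hg : g ∈ H), F g = f ⟨g, hg⟩ := fun g hg => dif_pos hg
  have hFout : ∀ g, g ∉ H → F g = 0 := fun g hg => dif_neg hg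
  have hAH : ∀ a ∈ A, a ∈ H := fun a ha => (hH a).2 ⟨a, ha, 1, Bψ.one_mem, (mul_one a).symm⟩
  have hBH : ∀ a ∈ Bψ, a ∈ H := fun a ha => (hH a).2 ⟨1, A.one_mem, a, ha, (one_mul a).symm⟩
  have hσA : ∀ a (ha : a ∈ A), σ ⟨a, hAH a ha⟩ = (ψ ⟨a, ha⟩ : ℂ) • 1 := by
    intro a ha
    have h1 := hpq' a 1 ha Bψ.one_mem (by rw [mul_one]; exact hAH a ha)
    simp only [mul_one] at h1
    have e1 : (⟨p ⟨a, hAH a ha⟩, hp _⟩ : A) = ⟨a, ha⟩ := Subtype.ext h1.1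
    have e2 : (⟨q ⟨a, hAH a ha⟩, hq _⟩ : Bψ) = 1 := Subtype.ext h1.2
    change (ψ ⟨p ⟨a, hAH a ha⟩, hp _⟩ : ℂ) • W.ρ ⟨q ⟨a, hAH a ha⟩, hq _⟩ = _
    rw [e1, e2, map_one]
  have hFl : ∀ a (ha : a ∈ A) g, F (a * g) = (ψ ⟨a, ha⟩ : ℂ) * F g := by
    intro a ha g
    by_cases hg : g ∈ H
    · rw [hFin g hg, hFin _ (H.mul_mem (hAH a ha) hg), hfσ, hfσ,
        show (⟨a * g, H.mul_mem (hAH a ha) hg⟩ : H) = ⟨a, hAH a ha⟩ * ⟨g, hg⟩ from rfl,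
        map_mul, hσA a ha, smul_mul_assoc, one_mul, map_smul, smul_eq_mul]
    · rw [hFout g hg, hFout _ (fun h => hg ((H.mul_mem_cancel_left (hAH a ha)).1 h)), mul_zero]
  have hFr : ∀ a (ha : a ∈ A) g, F (g * a) = (ψ ⟨a, ha⟩ : ℂ) * F g := by
    intro a ha g
    by_cases hg : g ∈ H
    · rw [hFin g hg, hFin _ (H.mul_mem hg (hAH a ha)), hfσ, hfσ,
        show (⟨g * a, H.mul_mem hg (hAH a ha)⟩ : H) = ⟨g, hg⟩ * ⟨a, hAH a ha⟩ from rfl,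
        map_mul, hσA a ha, mul_smul_comm, mul_one, map_smul, smul_eq_mul]
    · rw [hFout g hg, hFout _ (fun h => hg ((H.mul_mem_cancel_right (hAH a ha)).1 h)), mul_zero]
  have hFconj : ∀ z ∈ H, ∀ g, F (z⁻¹ * g * z) = F g := by
    intro z hz g
    by_cases hg : g ∈ H
    · have hm := H.mul_mem (H.mul_mem (H.inv_mem hz) hg) hz
      rw [hFin g hg, hFin _ hm, hfσ, hfσ,
        show (⟨z⁻¹ * g * z, hm⟩ : H) = (⟨z, hz⟩⁻¹ * ⟨g, hg⟩) * ⟨z, hz⟩ from rfl,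
        map_mul, LinearMap.trace_mul_comm, ← map_mul, mul_inv_cancel_left]
    · rw [hFout g hg, hFout]
      intro h
      apply hg
      have := H.mul_mem (H.mul_mem hz h) (H.inv_mem hz)
      simpa [mul_assoc] using this
  -- the inner sums
  let S : 𝒢 → ℂ := fun z => ∑ g, F g * F (z⁻¹ * g⁻¹ * z)
  have hSin : ∀ z ∈ H, S z = Nat.card H := by
    intro z hz
    rw [← hfnorm]
    simp only [S]
    rw [Finset.sum_congr rfl fun g _ => by rw [hFconj z hz g⁻¹]]
    symm
    refine Finset.sum_of_injOn (fun h : H => (h : 𝒢)) Subtype.val_injective.injOn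
      (fun _ _ => Finset.mem_coe.2 (Finset.mem_univ _)) ?_ ?_
    · intro g _ hg
      rw [hFout g, zero_mul]
      intro hgH
      exact hg ⟨⟨g, hgH⟩, by simp, rfl⟩
    · intro h _
      rw [hFin _ h.2, hFin _ (H.inv_mem h.2)]
      rfl
  have hSout : ∀ z, z ∉ H → S z = 0 := by
    intro z hz
    by_contra hS
    apply hz
    have hinv : ∀ (a : 𝒢) (ha : a ∈ A) (h' : z⁻¹ * a * z ∈ A),
        ψ ⟨z⁻¹ * a * z, h'⟩ = ψ ⟨a, ha⟩ := by
      intro a ha h'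
      have h1 : S z = (ψ ⟨a, ha⟩ : ℂ) * ((ψ ⟨z⁻¹ * a * z, h'⟩)⁻¹ : ℂˣ) * S z := by
        conv_lhs => simp only [S]
        rw [← Equiv.sum_comp (Equiv.mulLeft a)]
        simp only [S, Finset.mul_sum]
        refine Finset.sum_congr rfl fun g _ => ?_
        have e1 : z⁻¹ * (a * g)⁻¹ * z = (z⁻¹ * g⁻¹ * z) * (z⁻¹ * a * z)⁻¹ := by group
        rw [Equiv.coe_mulLeft, e1, hFl a ha, hFr _ (A.inv_mem h'),
          show (⟨(z⁻¹ * a * z)⁻¹, A.inv_mem h'⟩ : A) = ⟨z⁻¹ * a * z, h'⟩⁻¹ from rfl, map_inv]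
        ring
      have h2 := mul_right_cancel₀ hS ((one_mul _).trans h1)
      rw [← Units.val_mul, ← Units.val_one, Units.val_inj, eq_comm, mul_inv_eq_one] at h2
      exact h2.symm
    obtain ⟨a₀, ha₀, b, hb, rfl⟩ := hgen z
    refine (hH _).2 ⟨a₀, ha₀, b, (hBψ b).2 ⟨hb, fun a ha => ?_⟩, rfl⟩
    have e1 : (a₀ * b)⁻¹ * a * (a₀ * b) = b⁻¹ * a * b := by
      have : a * a₀ = a₀ * a := habel a ha a₀ ha₀
      rw [mul_inv_rev]
      calc b⁻¹ * a₀⁻¹ * a * (a₀ * b) = b⁻¹ * a₀⁻¹ * (a * a₀) * b := by group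
        _ = _ := by rw [this]; group
    have h3 := hinv a ha (by rw [e1]; simpa using hnorm.conj_mem a ha b⁻¹)
    rw [← h3]
    congr 1
    exact Subtype.ext e1.symm
  have hcardH : (Nat.card H : ℂ) ≠ 0 := by
    exact_mod_cast (Nat.card_pos (α := H)).ne'
  have hSsum : ∑ z, S z = (Nat.card H : ℂ) * Nat.card H := by
    have : ∑ h : H, (Nat.card H : ℂ) = ∑ z, S z := by
      refine Finset.sum_of_injOn (fun h : H => (h : 𝒢)) Subtype.val_injective.injOn
        (fun _ _ => Finset.mem_coe.2 (Finset.mem_univ _)) ?_ ?_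
      · intro g _ hg
        refine hSout g fun hgH => hg ⟨⟨g, hgH⟩, by simp, rfl⟩
      · intro h _
        exact (hSin _ h.2).symm
    rw [← this, Finset.sum_const, Finset.card_univ, nsmul_eq_mul, Nat.card_eq_fintype_card]
  have hchar : (fun g : 𝒢 => (Nat.card ↥H : ℂ)⁻¹ * ∑ x : 𝒢,
        if hx : x⁻¹ * g * x ∈ H then f ⟨x⁻¹ * g * x, hx⟩ else 0) =
      (FDRep.of (Representation.coind H.subtype σ)).character := by
    funext g
    refine Eq.trans ?_ (aux_ind_char H σ g).symm
    simp only [hfσ]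
  refine ⟨FDRep.of (Representation.coind H.subtype σ), ?_, hchar⟩
  rw [FDRep.simple_iff_char_is_norm_one, ← hchar]
  change ∑ g : 𝒢, ((Nat.card H : ℂ)⁻¹ * ∑ x : 𝒢, F (x⁻¹ * g * x)) *
    ((Nat.card H : ℂ)⁻¹ * ∑ y : 𝒢, F (y⁻¹ * g⁻¹ * y)) = _
  have hxy : ∀ x : 𝒢, ∑ g : 𝒢, ∑ y : 𝒢, F (x⁻¹ * g * x) * F (y⁻¹ * g⁻¹ * y) = ∑ z, S z := by
    intro x
    rw [Finset.sum_comm, ← Equiv.sum_comp (Equiv.mulLeft x)]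
    refine Finset.sum_congr rfl fun z _ => ?_
    rw [← Equiv.sum_comp (MulAut.conj x).toEquiv]
    refine Finset.sum_congr rfl fun g _ => ?_
    have e1 : (MulAut.conj x).toEquiv g = x * g * x⁻¹ := rfl
    rw [e1, Equiv.coe_mulLeft]
    congr 2 <;> group
  have : ∑ g : 𝒢, ((Nat.card H : ℂ)⁻¹ * ∑ x : 𝒢, F (x⁻¹ * g * x)) *
    ((Nat.card H : ℂ)⁻¹ * ∑ y : 𝒢, F (y⁻¹ * g⁻¹ * y)) =
      (Nat.card H : ℂ)⁻¹ * (Nat.card H : ℂ)⁻¹ *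
        ∑ x : 𝒢, ∑ g : 𝒢, ∑ y : 𝒢, F (x⁻¹ * g * x) * F (y⁻¹ * g⁻¹ * y) := by
    rw [Finset.sum_comm, Finset.mul_sum]
    refine Finset.sum_congr rfl fun g _ => ?_
    rw [mul_mul_mul_comm, Finset.sum_mul_sum]
  rw [this, Finset.sum_congr rfl fun x _ => hxy x, Finset.sum_const, Finset.card_univ, hSsum,
    nsmul_eq_mul, Nat.card_eq_fintype_card (α := 𝒢)]
  field_simp
end

section
/- Every irreducible complex character χ of 𝒢 is of the form χ = χ_{ψ,η} = Ind_{A·B^ψ}^𝒢(ψ₀η₀) for some homomorphism ψ : A → ℂˣ and some irreducible character η of B^ψ. Moreover, if {ψ_i} is a set of representatives of the B-orbits on the homomorphisms A → ℂˣ, then χ_{ψ_i,η} = χ_{ψ_j,η′} if and only if i = j and η = η′. -/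
open CategoryTheory Classical

attribute [local instance] Classical.propDecidable

namespace S15

theorem dual_sum {A : Type} [CommGroup A] [Fintype A] [Fintype (A →* ℂˣ)] (a : A) (ha : a ≠ 1) :
    ∑ ψ : A →* ℂˣ, (((ψ a)⁻¹ : ℂˣ) : ℂ) = 0 := by
  have : NeZero (Monoid.exponent A : ℂ) :=
    ⟨by exact_mod_cast Monoid.exponent_ne_zero_of_finite⟩
  have : NeZero (Monoid.exponent A) := ⟨Monoid.exponent_ne_zero_of_finite⟩
  obtain ⟨φ, hφ⟩ := CommGroup.exists_apply_ne_one_of_hasEnoughRootsOfUnity A ℂ ha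
  have h1 : ∑ ψ : A →* ℂˣ, (((ψ a)⁻¹ : ℂˣ) : ℂ) =
      (((φ a)⁻¹ : ℂˣ) : ℂ) * ∑ ψ : A →* ℂˣ, (((ψ a)⁻¹ : ℂˣ) : ℂ) := by
    rw [Finset.mul_sum]
    refine (Fintype.sum_equiv (Equiv.mulLeft φ) _ _ ?_).symm
    intro ψ
    simp [mul_comm]
  by_contra h
  have h2 : (((φ a)⁻¹ : ℂˣ) : ℂ) = 1 := by
    have := mul_right_cancel₀ h ((one_mul _).trans h1)
    exact this.symm
  apply hφ
  have : (φ a)⁻¹ = 1 := Units.ext h2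
  simpa using this

theorem finite_dual (A : Type) [CommGroup A] [Finite A] : Finite (A →* ℂˣ) := by
  have : NeZero (Monoid.exponent A : ℂ) :=
    ⟨by exact_mod_cast Monoid.exponent_ne_zero_of_finite⟩
  have : NeZero (Monoid.exponent A) := ⟨Monoid.exponent_ne_zero_of_finite⟩
  obtain ⟨e⟩ := CommGroup.monoidHom_mulEquiv_of_hasEnoughRootsOfUnity A ℂ
  exact Finite.of_equiv _ e.symm.toEquiv

theorem orth {A : Type} [Group A] [Fintype A] (φ ψ : A →* ℂˣ) :
    ∑ a : A, (((φ a)⁻¹ : ℂˣ) : ℂ) * (ψ a : ℂ) = if φ = ψ then (Nat.card A : ℂ) else 0 := by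
  split_ifs with h
  · subst h; simp
  · let θ : A →* ℂ := (Units.coeHom ℂ).comp 
      { toFun := fun a => (φ a)⁻¹ * ψ a
        map_one' := by simp
        map_mul' := fun a b => by simp only [map_mul, mul_inv]; exact mul_mul_mul_comm _ _ _ _ }
    have := sum_hom_units_eq_zero θ (fun h1 => h (by
      ext a
      have h2 := DFunLike.congr_fun h1 a
      have h3 : ((φ a)⁻¹ * ψ a) = 1 := Units.ext h2
      rw [inv_mul_eq_one] at h3
      rw [h3]))
    rw [← this]
    simp [θ]

/-- invariant submodules of a simple object are trivial -/
theorem simple_sub {G : Type} [Group G] (V : FDRep ℂ G) [Simple V] (U : Submodule ℂ V)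
    (hU : ∀ g, ∀ v ∈ U, V.ρ g v ∈ U) (v : V) (hv : v ∈ U) (hv0 : v ≠ 0) : U = ⊤ := by
  let σ : Representation ℂ G U :=
    { toFun := fun g => (V.ρ g).restrict (hU g)
      map_one' := by ext; simp
      map_mul' := fun x y => by ext; simp }
  let i : FDRep.of σ ⟶ V := ⟨InducedCategory.homMk (ModuleCat.ofHom U.subtype), fun g => by
    ext1; rfl⟩
  have hi : Mono i := by
    apply (forget (FDRep ℂ G)).mono_of_mono_map
    rw [CategoryTheory.mono_iff_injective]
    exact U.subtype_injective
  have hne : i ≠ 0 := fun h => by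
    have : i.hom.hom.hom ⟨v, hv⟩ = (0 : V) := by rw [h]; rfl
    exact hv0 this
  have : IsIso i := (Simple.mono_isIso_iff_nonzero i).2 hne
  rw [eq_top_iff]
  intro w _
  have h1 : i.hom.hom.hom ((inv i).hom.hom.hom w) = w := by
    have : (inv i ≫ i).hom.hom.hom w = w := by rw [IsIso.inv_hom_id]; rfl
    exact this
  rw [← h1]
  exact Subtype.mem _

theorem of_simple {G : Type} [Group G] [Fintype G] {V : Type} [AddCommGroup V] [Module ℂ V]
    [FiniteDimensional ℂ V] (ρ : Representation ℂ G V) [ρ.IsIrreducible] :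
    Simple (FDRep.of ρ) := by
  rw [FDRep.simple_iff_char_is_norm_one]
  have := invertibleOfNonzero (NeZero.ne (Nat.card G : ℂ))
  have h := Representation.char_orthonormal ρ ρ
  rw [if_pos ⟨Representation.Equiv.refl ρ⟩] at h
  rw [inv_mul_eq_one₀ (NeZero.ne _)] at h
  exact h.symm

theorem char_one_ne {G : Type} [Group G] [Fintype G] (V : FDRep ℂ G) (hV : Simple V) :
    V.character 1 ≠ 0 := by
  rw [FDRep.char_one]
  intro h
  have h0 : Module.finrank ℂ V = 0 := by exact_mod_cast h
  have := Module.finrank_zero_iff.1 h0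
  have h1 := (FDRep.simple_iff_char_is_norm_one V).1 hV
  have h2 : ∀ g, V.character g = 0 := fun g => by
    have : V.ρ g = 0 := by ext v; exact Subsingleton.elim _ _
    simp [FDRep.character, this]
  simp [h2] at h1
  exact Fintype.card_ne_zero (by exact_mod_cast h1.symm)

end S15
namespace S15

section grp
variable {G : Type} [Group G] (A : Subgroup G) [A.Normal]

/-- the conjugation action on characters of `A` -/
def tw (x : G) (ψ : ↥A →* ℂˣ) : ↥A →* ℂˣ :=
  ψ.comp (MulAut.conjNormal x⁻¹ : MulAut ↥A).toMonoidHom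

theorem tw_apply (x : G) (ψ : ↥A →* ℂˣ) (a : ↥A) :
    tw A x ψ a = ψ (MulAut.conjNormal x⁻¹ a) := rfl

theorem tw_mul (x y : G) (ψ : ↥A →* ℂˣ) : tw A (x * y) ψ = tw A x (tw A y ψ) := by
  ext a
  simp [tw_apply, mul_inv_rev]

theorem tw_one (ψ : ↥A →* ℂˣ) : tw A 1 ψ = ψ := by
  ext a
  simp [tw_apply]

theorem tw_inv (x : G) (ψ φ : ↥A →* ℂˣ) : tw A x⁻¹ ψ = φ ↔ tw A x φ = ψ := by
  constructor
  · rintro rfl; rw [← tw_mul, mul_inv_cancel, tw_one]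
  · rintro rfl; rw [← tw_mul, inv_mul_cancel, tw_one]

theorem tw_mem (habel : ∀ a ∈ A, ∀ a' ∈ A, a * a' = a' * a) (x : G) (hx : x ∈ A)
    (ψ : ↥A →* ℂˣ) : tw A x ψ = ψ := by
  ext a
  rw [tw_apply]
  congr 2
  apply Subtype.ext
  rw [MulAut.conjNormal_apply]
  rw [habel _ (A.inv_mem hx) _ a.2]
  group

theorem tw_iff (x : G) (ψ φ : ↥A →* ℂˣ) (hc : ∀ a ∈ A, x⁻¹ * a * x ∈ A) :
    tw A x ψ = φ ↔ ∀ (a : G) (ha : a ∈ A), ψ ⟨x⁻¹ * a * x, hc a ha⟩ = φ ⟨a, ha⟩ := by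
  have key : ∀ (a : G) (ha : a ∈ A), tw A x ψ ⟨a, ha⟩ = ψ ⟨x⁻¹ * a * x, hc a ha⟩ := by
    intro a ha
    rw [tw_apply]
    congr 1
    apply Subtype.ext
    rw [MulAut.conjNormal_apply]
    simp
  constructor
  · rintro rfl a ha
    exact (key a ha).symm
  · intro h
    ext ⟨a, ha⟩
    rw [key, h]

/-- The basic setup. -/
structure Setup (B Bψ H : Subgroup G) (ψ : ↥A →* ℂˣ) : Prop where
  habel : ∀ a ∈ A, ∀ a' ∈ A, a * a' = a' * a
  hint : A ⊓ B = ⊥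
  hgen : ∀ g : G, ∃ a ∈ A, ∃ b ∈ B, g = a * b
  hB : ∀ g : G, g ∈ Bψ ↔ g ∈ B ∧ tw A g ψ = ψ
  hH : ∀ g : G, g ∈ H ↔ ∃ a ∈ A, ∃ b ∈ Bψ, g = a * b

variable {A} {B Bψ H : Subgroup G} {ψ : ↥A →* ℂˣ}

theorem Setup.mem_iff (S : Setup A B Bψ H ψ) (g : G) : g ∈ H ↔ tw A g ψ = ψ := by
  rw [S.hH]
  constructor
  · rintro ⟨a, ha, b, hb, rfl⟩
    rw [tw_mul, ((S.hB b).1 hb).2, tw_mem A S.habel a ha]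
  · intro h
    obtain ⟨a, ha, b, hb, rfl⟩ := S.hgen g
    refine ⟨a, ha, b, (S.hB b).2 ⟨hb, ?_⟩, rfl⟩
    rwa [tw_mul, tw_mem A S.habel a ha] at h

theorem Setup.A_le (S : Setup A B Bψ H ψ) : A ≤ H := fun a ha =>
  (S.hH a).2 ⟨a, ha, 1, Bψ.one_mem, by simp⟩

theorem Setup.B_le (S : Setup A B Bψ H ψ) : Bψ ≤ H := fun b hb =>
  (S.hH b).2 ⟨1, A.one_mem, b, hb, by simp⟩

theorem Setup.unique (S : Setup A B Bψ H ψ) {a b a' b' : G} (ha : a ∈ A) (hb : b ∈ Bψ)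
    (ha' : a' ∈ A) (hb' : b' ∈ Bψ) (h : a * b = a' * b') : a = a' ∧ b = b' := by
  have h1 : a'⁻¹ * a = b' * b⁻¹ := by
    rw [inv_mul_eq_iff_eq_mul, ← mul_assoc, ← h]; group
  have h2 : a'⁻¹ * a ∈ A ⊓ B := ⟨A.mul_mem (A.inv_mem ha') ha, by
    rw [h1]; exact B.mul_mem ((S.hB _).1 hb').1 (B.inv_mem ((S.hB _).1 hb).1)⟩
  rw [S.hint, Subgroup.mem_bot] at h2
  have h3 : a' = a := inv_mul_eq_one.1 h2
  subst h3
  exact ⟨rfl, mul_left_cancel h⟩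

/-- extension by zero -/
noncomputable def ext0 (f : ↥H → ℂ) (g : G) : ℂ := if hx : g ∈ H then f ⟨g, hx⟩ else 0

theorem ext0_mem (f : ↥H → ℂ) (g : G) (hg : g ∈ H) : ext0 f g = f ⟨g, hg⟩ := dif_pos hg

theorem ext0_mul (S : Setup A B Bψ H ψ) (η : ↥Bψ → ℂ) (f : ↥H → ℂ)
    (hf : ∀ (a b : G) (ha : a ∈ A) (hb : b ∈ Bψ) (hab : a * b ∈ H),
          f ⟨a * b, hab⟩ = (ψ ⟨a, ha⟩ : ℂ) * η ⟨b, hb⟩) (a : ↥A) (g : G) :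
    ext0 f (a * g) = ψ a * ext0 f g := by
  by_cases hg : g ∈ H
  · have h2 : (a : G) * g ∈ H := H.mul_mem (S.A_le a.2) hg
    rw [ext0_mem f _ hg, ext0_mem f _ h2]
    obtain ⟨a', ha', b, hb, rfl⟩ := (S.hH g).1 hg
    rw [hf a' b ha' hb]
    have h3 : (⟨(a : G) * (a' * b), h2⟩ : ↥H) = ⟨(a * a') * b, by rwa [mul_assoc]⟩ :=
      Subtype.ext (mul_assoc _ _ _).symm
    rw [h3, hf _ b (A.mul_mem a.2 ha') hb]
    have h4 : (⟨(a : G) * a', A.mul_mem a.2 ha'⟩ : ↥A) = a * ⟨a', ha'⟩ := rfl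
    rw [h4, map_mul, Units.val_mul, mul_assoc]
  · have h2 : (a : G) * g ∉ H := fun h => hg (by
      have := H.mul_mem (H.inv_mem (S.A_le a.2)) h
      simpa using this)
    simp [ext0, hg, h2]

theorem ext0_conj (S : Setup A B Bψ H ψ) (η : ↥Bψ → ℂ) (f : ↥H → ℂ)
    (hη : ∀ b x : ↥Bψ, η (x⁻¹ * b * x) = η b)
    (hf : ∀ (a b : G) (ha : a ∈ A) (hb : b ∈ Bψ) (hab : a * b ∈ H),
          f ⟨a * b, hab⟩ = (ψ ⟨a, ha⟩ : ℂ) * η ⟨b, hb⟩) (b x : G) (hb : b ∈ Bψ) (hx : x ∈ H) :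
    ext0 f (x⁻¹ * b * x) = η ⟨b, hb⟩ := by
  obtain ⟨a, ha, c, hc, rfl⟩ := (S.hH x).1 hx
  let a' : ↥A := ⟨a, ha⟩
  have h1 : (a * c)⁻¹ * b * (a * c) =
      ((MulAut.conjNormal c⁻¹ (a'⁻¹ * MulAut.conjNormal b a') : ↥A) : G) * (c⁻¹ * b * c) := by
    simp only [MulAut.conjNormal_apply, Subgroup.coe_mul, Subgroup.coe_inv, a']
    group
  rw [h1, ext0_mul S η f hf, ← tw_apply, ((S.hB c).1 hc).2, map_mul]
  have h2 : ψ (MulAut.conjNormal b a') = ψ a' := by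
    have := (tw_inv A b ψ ψ).2 ((S.hB b).1 hb).2
    conv_rhs => rw [← this, tw_apply, inv_inv]
  have h3 : c⁻¹ * b * c ∈ Bψ := Bψ.mul_mem (Bψ.mul_mem (Bψ.inv_mem hc) hb) hc
  rw [h2, ext0_mem f _ (S.B_le h3)]
  have h4 : (⟨c⁻¹ * b * c, S.B_le h3⟩ : ↥H) = ⟨1 * (c⁻¹ * b * c), by simpa using S.B_le h3⟩ :=
    Subtype.ext (one_mul _).symm
  rw [h4, hf 1 _ A.one_mem h3]
  have h5 : (⟨1, A.one_mem⟩ : ↥A) = 1 := rfl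
  rw [h5, ← hη ⟨b, hb⟩ ⟨c, hc⟩]
  simp
  rfl

/-- induced function -/
noncomputable def ind [Fintype G] (f : ↥H → ℂ) (g : G) : ℂ :=
  (Nat.card ↥H : ℂ)⁻¹ * ∑ x : G, ext0 f (x⁻¹ * g * x)

theorem fourier [Fintype G] (S : Setup A B Bψ H ψ) (η : ↥Bψ → ℂ) (f : ↥H → ℂ)
    (hf : ∀ (a b : G) (ha : a ∈ A) (hb : b ∈ Bψ) (hab : a * b ∈ H),
          f ⟨a * b, hab⟩ = (ψ ⟨a, ha⟩ : ℂ) * η ⟨b, hb⟩) (φ : ↥A →* ℂˣ) (b : G) :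
    ∑ a : ↥A, (((φ a)⁻¹ : ℂˣ) : ℂ) * ind f (a * b) =
      (Nat.card ↥H : ℂ)⁻¹ * ∑ x : G,
        (if φ = tw A x ψ then (Nat.card ↥A : ℂ) else 0) * ext0 f (x⁻¹ * b * x) := by
  simp only [ind, Finset.mul_sum]
  rw [Finset.sum_comm]
  refine Finset.sum_congr rfl fun x _ => ?_
  rw [← orth φ, Finset.sum_mul, Finset.mul_sum]
  refine Finset.sum_congr rfl fun a _ => ?_
  have h1 : x⁻¹ * (a * b) * x = ((MulAut.conjNormal x⁻¹ a : ↥A) : G) * (x⁻¹ * b * x) := by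
    rw [MulAut.conjNormal_apply]; group
  rw [h1, ext0_mul S η f hf, ← tw_apply]
  ring

theorem fourier_self [Fintype G] (S : Setup A B Bψ H ψ) (η : ↥Bψ → ℂ) (f : ↥H → ℂ)
    (hη : ∀ b x : ↥Bψ, η (x⁻¹ * b * x) = η b)
    (hf : ∀ (a b : G) (ha : a ∈ A) (hb : b ∈ Bψ) (hab : a * b ∈ H),
          f ⟨a * b, hab⟩ = (ψ ⟨a, ha⟩ : ℂ) * η ⟨b, hb⟩) (b : G) (hb : b ∈ Bψ) :
    ∑ a : ↥A, (((ψ a)⁻¹ : ℂˣ) : ℂ) * ind f (a * b) = Nat.card ↥A * η ⟨b, hb⟩ := by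
  rw [fourier S η f hf]
  have h1 : ∀ x : G, (if ψ = tw A x ψ then (Nat.card ↥A : ℂ) else 0) * ext0 f (x⁻¹ * b * x) =
      if x ∈ H then (Nat.card ↥A : ℂ) * η ⟨b, hb⟩ else 0 := by
    intro x
    by_cases hx : x ∈ H
    · rw [if_pos hx, if_pos ((S.mem_iff x).1 hx).symm, ext0_conj S η f hη hf b x hb hx]
    · rw [if_neg hx, if_neg (fun h => hx ((S.mem_iff x).2 h.symm)), zero_mul]
  simp only [h1]
  rw [← Finset.sum_filter, Finset.sum_const, nsmul_eq_mul]
  have h2 : (Finset.univ.filter (fun x : G => x ∈ H)).card = Nat.card ↥H := by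
    rw [Nat.card_eq_fintype_card, Fintype.card_subtype]
  rw [h2, inv_mul_cancel_left₀]
  exact_mod_cast Nat.card_pos.ne'

theorem char_class {K : Type} [Group K] (W : FDRep ℂ K) (b x : K) :
    W.character (x⁻¹ * b * x) = W.character b := by
  simpa using W.char_conj b x⁻¹

theorem inj [Fintype G] {Bψ' H' : Subgroup G} {ψ' : ↥A →* ℂˣ}
    (S : Setup A B Bψ H ψ) (S' : Setup A B Bψ' H' ψ')
    (W : FDRep ℂ ↥Bψ) (W' : FDRep ℂ ↥Bψ') (hW' : Simple W')
    (f : ↥H → ℂ) (f' : ↥H' → ℂ)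
    (hf : ∀ (a b : G) (ha : a ∈ A) (hb : b ∈ Bψ) (hab : a * b ∈ H),
          f ⟨a * b, hab⟩ = (ψ ⟨a, ha⟩ : ℂ) * W.character ⟨b, hb⟩)
    (hf' : ∀ (a b : G) (ha : a ∈ A) (hb : b ∈ Bψ') (hab : a * b ∈ H'),
          f' ⟨a * b, hab⟩ = (ψ' ⟨a, ha⟩ : ℂ) * W'.character ⟨b, hb⟩)
    (horb : (∃ b ∈ B, ψ' = tw A b ψ) → ψ = ψ') :
    ind f = ind f' ↔ ψ = ψ' ∧ HEq W.character W'.character := by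
  have hA : (Nat.card ↥A : ℂ) ≠ 0 := by exact_mod_cast Nat.card_pos.ne'
  constructor
  · intro h
    have hψ : ψ = ψ' := by
      apply horb
      by_contra hno
      have h1 := fourier_self S' W'.character f' (char_class W') hf' 1 (one_mem _)
      rw [← h, fourier S W.character f hf] at h1
      rw [Finset.sum_eq_zero, mul_zero] at h1
      · rcases mul_eq_zero.1 h1.symm with h2 | h2
        · exact hA h2
        · exact char_one_ne W' hW' h2
      · intro x _
        rw [if_neg, zero_mul]
        intro hx
        obtain ⟨a, ha, b, hb, rfl⟩ := S.hgen x
        exact hno ⟨b, hb, by rwa [tw_mul, tw_mem A S.habel a ha] at hx⟩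
    subst hψ
    refine ⟨rfl, ?_⟩
    have hBB : Bψ = Bψ' := by ext g; rw [S.hB, S'.hB]
    subst hBB
    apply heq_of_eq
    funext b
    have h1 := fourier_self S W.character f (char_class W) hf b b.2
    have h2 := fourier_self S' W'.character f' (char_class W') hf' b b.2
    rw [h, h2] at h1
    exact (mul_left_cancel₀ hA h1).symm
  · rintro ⟨rfl, h⟩
    have hBB : Bψ = Bψ' := by ext g; rw [S.hB, S'.hB]
    subst hBB
    have hHH : H = H' := by ext g; rw [S.hH, S'.hH]
    subst hHH
    have h := eq_of_heq h
    have : f = f' := by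
      funext ⟨g, hg⟩
      obtain ⟨a, ha, b, hb, rfl⟩ := (S.hH g).1 hg
      rw [hf a b ha hb, hf' a b ha hb, h]
    rw [this]

end grp
end S15
namespace S15

section rep
variable {G : Type} [Group G] [Fintype G] {A : Subgroup G} [A.Normal]
variable {V : Type} [AddCommGroup V] [Module ℂ V] (ρ : Representation ℂ G V)

/-- projection to the isotypic component -/
noncomputable def PP (ψ : ↥A →* ℂˣ) : Module.End ℂ V :=
  (Nat.card ↥A : ℂ)⁻¹ • ∑ a : ↥A, (((ψ a)⁻¹ : ℂˣ) : ℂ) • ρ (a : G)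

theorem cardA_ne : (Nat.card ↥A : ℂ) ≠ 0 := by exact_mod_cast Nat.card_pos.ne'

theorem PP_mul_rho (ψ : ↥A →* ℂˣ) (a : ↥A) : PP ρ ψ * ρ a = (ψ a : ℂ) • PP ρ ψ := by
  unfold PP
  rw [smul_mul_assoc, smul_comm]
  congr 1
  rw [Finset.sum_mul, Finset.smul_sum]
  refine Fintype.sum_equiv (Equiv.mulRight a) _ _ fun c => ?_
  have h1 : (ψ a : ℂ) * (((ψ (c * a))⁻¹ : ℂˣ) : ℂ) = (((ψ c)⁻¹ : ℂˣ) : ℂ) := by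
    rw [← Units.val_mul, map_mul, mul_inv, mul_comm, mul_assoc, inv_mul_cancel, mul_one]
  simp only [Equiv.coe_mulRight, smul_smul, h1, smul_mul_assoc, Subgroup.coe_mul, map_mul ρ]

theorem rho_PP (ψ : ↥A →* ℂˣ) (x : G) : ρ x * PP ρ ψ = PP ρ (tw A x ψ) * ρ x := by
  unfold PP
  rw [smul_mul_assoc, mul_smul_comm]
  congr 1
  rw [Finset.sum_mul, Finset.mul_sum]
  refine Fintype.sum_equiv (MulAut.conjNormal x : MulAut ↥A).toEquiv _ _ fun c => ?_
  have h1 : tw A x ψ (MulAut.conjNormal x c) = ψ c := by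
    rw [tw_apply]; simp
  simp [h1, ← map_mul, MulAut.conjNormal_apply]

theorem PP_mul_PP (ψ φ : ↥A →* ℂˣ) : PP ρ ψ * PP ρ φ = if φ = ψ then PP ρ ψ else 0 := by
  conv_lhs => rw [PP.eq_def ρ φ]
  rw [mul_smul_comm, Finset.mul_sum]
  simp only [mul_smul_comm, PP_mul_rho, smul_smul]
  rw [← Finset.sum_smul, orth, smul_smul]
  split_ifs
  · rw [inv_mul_cancel₀ cardA_ne, one_smul]
  · simp

theorem PP_idem (ψ : ↥A →* ℂˣ) : PP ρ ψ * PP ρ ψ = PP ρ ψ := by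
  rw [PP_mul_PP, if_pos rfl]

theorem exists_PP [Nontrivial V] (habel : ∀ a ∈ A, ∀ a' ∈ A, a * a' = a' * a) :
    ∃ ψ : ↥A →* ℂˣ, PP ρ ψ ≠ 0 := by
  by_contra! hno
  let _ : CommGroup ↥A := { (inferInstance : Group ↥A) with
    mul_comm := fun a b => Subtype.ext (habel a a.2 b b.2) }
  have := finite_dual ↥A
  let _ : Fintype (↥A →* ℂˣ) := Fintype.ofFinite _
  have h1 : ∑ ψ : ↥A →* ℂˣ, (Nat.card ↥A : ℂ) • PP ρ ψ =
      (Fintype.card (↥A →* ℂˣ) : ℂ) • (1 : Module.End ℂ V) := by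
    simp only [PP, smul_smul, mul_inv_cancel₀ (cardA_ne (A := A)), one_smul]
    rw [Finset.sum_comm]
    simp only [← Finset.sum_smul]
    rw [Finset.sum_eq_single 1]
    · simp
    · intro a _ ha
      have := dual_sum a ha
      rw [this, zero_smul]
    · simp
  rw [Finset.sum_eq_zero (fun ψ _ => by rw [hno ψ, smul_zero])] at h1
  rcases smul_eq_zero.1 h1.symm with h2 | h2
  · exact Fintype.card_ne_zero (by exact_mod_cast h2)
  · exact one_ne_zero h2

variable {B Bψ H : Subgroup G} {ψ : ↥A →* ℂˣ}

theorem comm_H (S : Setup A B Bψ H ψ) (x : G) (hx : x ∈ H) :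
    ρ x * PP ρ ψ = PP ρ ψ * ρ x := by
  rw [rho_PP, (S.mem_iff x).1 hx]

theorem not_H (S : Setup A B Bψ H ψ) (x : G) (hx : x ∉ H) :
    PP ρ ψ * ρ x * PP ρ ψ = 0 := by
  rw [mul_assoc, rho_PP, ← mul_assoc, PP_mul_PP, if_neg, zero_mul]
  intro h
  exact hx ((S.mem_iff x).2 h)

/-- The representation of the stabilizer on the isotypic component. -/
noncomputable def WW (S : Setup A B Bψ H ψ) :
    Representation ℂ ↥Bψ (LinearMap.range (PP ρ ψ)) where
  toFun b := (ρ (b : G)).restrict (p := LinearMap.range (PP ρ ψ))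
    (q := LinearMap.range (PP ρ ψ)) (by
      rintro _ ⟨v, rfl⟩
      exact ⟨ρ (b : G) v, (LinearMap.congr_fun (comm_H ρ S b (S.B_le b.2)) v).symm⟩)
  map_one' := by ext; simp
  map_mul' x y := by ext; simp

theorem PP_range (ψ : ↥A →* ℂˣ) (v : V) (hv : v ∈ LinearMap.range (PP ρ ψ)) : PP ρ ψ v = v := by
  obtain ⟨w, rfl⟩ := hv
  exact LinearMap.congr_fun (PP_idem ρ ψ) w

theorem WW_trace [FiniteDimensional ℂ V] (S : Setup A B Bψ H ψ) (b : ↥Bψ) :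
    LinearMap.trace ℂ V (PP ρ ψ * ρ (b : G)) = (FDRep.of (WW ρ S)).character b := by
  have h1 : PP ρ ψ * ρ (b : G) = (LinearMap.range (PP ρ ψ)).subtype ∘ₗ
    ((PP ρ ψ).rangeRestrict ∘ₗ ρ (b : G)) := by ext v; rfl
  rw [h1, LinearMap.trace_comp_comm']
  unfold FDRep.character
  congr 1
  ext ⟨v, hv⟩
  change PP ρ ψ (ρ (b : G) v) = ρ (b : G) v
  apply PP_range
  obtain ⟨v, rfl⟩ := hv
  exact ⟨ρ (b : G) v, (LinearMap.congr_fun (comm_H ρ S b (S.B_le b.2)) v).symm⟩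

theorem WW_irr (S : Setup A B Bψ H ψ) (hne : PP ρ ψ ≠ 0)
    (hsim : ∀ U : Submodule ℂ V, (∀ g, ∀ v ∈ U, ρ g v ∈ U) → ∀ v ∈ U, v ≠ 0 → U = ⊤) :
    (WW ρ S).IsIrreducible := by
  have hnt : Nontrivial (Subrepresentation (WW ρ S)) := by
    refine ⟨⊥, ⊤, fun h => hne ?_⟩
    ext v
    have h1 : (⟨PP ρ ψ v, ⟨v, rfl⟩⟩ : LinearMap.range (PP ρ ψ)) ∈
        (⊥ : Subrepresentation (WW ρ S)) := by rw [h]; trivial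
    have h2 : (⟨PP ρ ψ v, ⟨v, rfl⟩⟩ : LinearMap.range (PP ρ ψ)) = 0 := h1
    exact congrArg Subtype.val h2
  refine { eq_bot_or_eq_top := fun W0 => ?_ }
  by_cases h0 : ∀ w ∈ W0, w = 0
  · left
    apply Subrepresentation.toSubmodule_injective
    exact (Submodule.eq_bot_iff _).2 h0
  · right
    push Not at h0
    obtain ⟨⟨w, hw⟩, hw0, hwne⟩ := h0
    let U0 : Submodule ℂ V := W0.toSubmodule.map (LinearMap.range (PP ρ ψ)).subtype
    let U : Submodule ℂ V := ⨅ x : G, U0.comap (PP ρ ψ * ρ x)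
    have hmem : ∀ v, v ∈ U ↔ ∀ x, PP ρ ψ (ρ x v) ∈ U0 := fun v => by simp [U]
    have hU : U = ⊤ := by
      apply hsim U ?_ w ?_ (fun h => hwne (Subtype.ext h))
      · intro g v hv
        rw [hmem] at hv ⊢
        intro x
        have := hv (x * g)
        rwa [map_mul] at this
      · rw [hmem]
        intro x
        have hw1 := PP_range ρ ψ w hw
        by_cases hx : x ∈ H
        · obtain ⟨a, ha, b, hb, rfl⟩ := (S.hH x).1 hx
          have h1 : PP ρ ψ (ρ (a * b) w) = (ψ ⟨a, ha⟩ : ℂ) • ρ b w := by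
            have h2 := LinearMap.congr_fun (PP_mul_rho ρ ψ ⟨a, ha⟩) (ρ b w)
            rw [map_mul]
            refine h2.trans ?_
            have h3 := LinearMap.congr_fun (comm_H ρ S b (S.B_le hb)) w
            change ρ b (PP ρ ψ w) = PP ρ ψ (ρ b w) at h3
            rw [hw1] at h3
            rw [LinearMap.smul_apply, ← h3]
          rw [h1]
          apply U0.smul_mem
          exact ⟨_, W0.apply_mem_toSubmodule ⟨b, hb⟩ hw0, rfl⟩
        · have h1 := LinearMap.congr_fun (not_H ρ S x hx) w
          change PP ρ ψ (ρ x (PP ρ ψ w)) = 0 at h1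
          rw [hw1] at h1
          rw [h1]
          exact U0.zero_mem
    apply Subrepresentation.toSubmodule_injective
    refine eq_top_iff.2 ?_
    rintro ⟨v, hv⟩ _
    have h1 : v ∈ U := by rw [hU]; trivial
    have h2 := (hmem v).1 h1 1
    rw [map_one, Module.End.one_apply, PP_range ρ ψ v hv] at h2
    obtain ⟨⟨v', hv'⟩, h3, h4⟩ := h2
    change v' = v at h4
    subst h4
    exact h3

theorem sum_proj (S : Setup A B Bψ H ψ) (hne : PP ρ ψ ≠ 0)
    (hsim : ∀ U : Submodule ℂ V, (∀ g, ∀ v ∈ U, ρ g v ∈ U) → ∀ v ∈ U, v ≠ 0 → U = ⊤) :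
    (Nat.card ↥H : ℂ)⁻¹ • ∑ x : G, ρ x * PP ρ ψ * ρ x⁻¹ = 1 := by
  set Q : Module.End ℂ V := (Nat.card ↥H : ℂ)⁻¹ • ∑ x : G, ρ x * PP ρ ψ * ρ x⁻¹ with hQ
  have hcomm : ∀ g, Q * ρ g = ρ g * Q := by
    intro g
    rw [hQ, smul_mul_assoc, mul_smul_comm, Finset.sum_mul, Finset.mul_sum]
    congr 1
    refine Fintype.sum_equiv (Equiv.mulLeft g⁻¹) _ _ fun x => ?_
    simp only [Equiv.coe_mulLeft, mul_inv_rev, inv_inv, map_mul, ← mul_assoc]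
    rw [← map_mul ρ g, mul_inv_cancel, map_one, one_mul]
  have hQP : Q * PP ρ ψ = PP ρ ψ := by
    rw [hQ, smul_mul_assoc, Finset.sum_mul]
    have h1 : ∀ x : G, ρ x * PP ρ ψ * ρ x⁻¹ * PP ρ ψ = if x ∈ H then PP ρ ψ else 0 := by
      intro x
      split_ifs with hx
      · rw [mul_assoc, comm_H ρ S _ (H.inv_mem hx), ← mul_assoc, mul_assoc (ρ x), PP_idem,
          comm_H ρ S x hx, mul_assoc, ← map_mul, mul_inv_cancel, map_one, mul_one]
      · rw [mul_assoc, mul_assoc, ← mul_assoc (PP ρ ψ), not_H ρ S x⁻¹, mul_zero]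
        intro h
        exact hx (by simpa using H.inv_mem h)
    simp only [h1]
    rw [← Finset.sum_filter, Finset.sum_const]
    have h2 : (Finset.univ.filter (fun x : G => x ∈ H)).card = Nat.card ↥H := by
      rw [Nat.card_eq_fintype_card, Fintype.card_subtype]
    rw [h2, ← Nat.cast_smul_eq_nsmul ℂ, smul_smul, inv_mul_cancel₀ (by exact_mod_cast Nat.card_pos.ne'), one_smul]
  obtain ⟨v, hv⟩ : ∃ v, PP ρ ψ v ≠ 0 := by
    by_contra! h
    exact hne (LinearMap.ext h)
  have hU := hsim (LinearMap.eqLocus Q 1) (fun g v hv => by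
    rw [LinearMap.mem_eqLocus] at hv ⊢
    have := LinearMap.congr_fun (hcomm g) v
    change Q (ρ g v) = ρ g (Q v) at this
    rw [this, hv]; rfl) (PP ρ ψ v) (by
    rw [LinearMap.mem_eqLocus]
    exact LinearMap.congr_fun hQP v) hv
  exact LinearMap.eqLocus_eq_top.1 hU

theorem char_eq (S : Setup A B Bψ H ψ) (hne : PP ρ ψ ≠ 0)
    (hsim : ∀ U : Submodule ℂ V, (∀ g, ∀ v ∈ U, ρ g v ∈ U) → ∀ v ∈ U, v ≠ 0 → U = ⊤) (g : G) :
    LinearMap.trace ℂ V (ρ g) =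
      ind (H := H) (fun h => LinearMap.trace ℂ V (PP ρ ψ * ρ (h : G))) g := by
  have h1 : ρ g = ((Nat.card ↥H : ℂ)⁻¹ • ∑ x : G, ρ x * PP ρ ψ * ρ x⁻¹) * ρ g := by
    rw [sum_proj ρ S hne hsim, one_mul]
  rw [h1, smul_mul_assoc, map_smul, Finset.sum_mul, map_sum, ind, smul_eq_mul]
  congr 1
  refine Finset.sum_congr rfl fun x _ => ?_
  have h2 : LinearMap.trace ℂ V (ρ x * PP ρ ψ * ρ x⁻¹ * ρ g) =
      LinearMap.trace ℂ V (PP ρ ψ * ρ (x⁻¹ * g * x)) := by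
    rw [mul_assoc, mul_assoc, LinearMap.trace_mul_comm, map_mul ρ, map_mul ρ]
    simp only [mul_assoc]
  rw [h2]
  by_cases hx : x⁻¹ * g * x ∈ H
  · rw [ext0_mem _ _ hx]
  · have h3 : ext0 (H := H) (fun h => LinearMap.trace ℂ V (PP ρ ψ * ρ (h : G)))
        (x⁻¹ * g * x) = 0 := dif_neg hx
    rw [h3, ← PP_idem, mul_assoc, LinearMap.trace_mul_comm, not_H ρ S _ hx, map_zero]

end rep

theorem exists_setup {G : Type} [Group G] {A : Subgroup G} [A.Normal] (B : Subgroup G)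
    (habel : ∀ a ∈ A, ∀ a' ∈ A, a * a' = a' * a)
    (hint : A ⊓ B = ⊥) (hgen : ∀ g : G, ∃ a ∈ A, ∃ b ∈ B, g = a * b) (ψ : ↥A →* ℂˣ) :
    ∃ Bψ H : Subgroup G, Setup A B Bψ H ψ := by
  let H : Subgroup G :=
    { carrier := {g | tw A g ψ = ψ}
      one_mem' := tw_one A ψ
      mul_mem' := fun {x y} hx hy => by
        change tw A (x * y) ψ = ψ
        rw [tw_mul, show tw A y ψ = ψ from hy, show tw A x ψ = ψ from hx]
      inv_mem' := fun {x} hx => (tw_inv A x ψ ψ).2 hx }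
  refine ⟨B ⊓ H, H, habel, hint, hgen, fun g => Iff.rfl, fun g => ?_⟩
  have hA : A ≤ H := fun a ha => tw_mem A habel a ha ψ
  constructor
  · intro hg
    obtain ⟨a, ha, b, hb, rfl⟩ := hgen g
    exact ⟨a, ha, b, ⟨hb, by simpa using H.mul_mem (H.inv_mem (hA ha)) hg⟩, rfl⟩
  · rintro ⟨a, ha, b, hb, rfl⟩
    exact H.mul_mem (hA ha) hb.2

end S15

/-- Mackey's little-group method, classification part.  Let `𝒢 = A ⋊ B` be a finite
group with `A` abelian and normal, `A ∩ B = {1}` and `AB = 𝒢`.  (1) Every irreducible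
complex character `χ` of `𝒢` is of the form `χ = χ_{ψ,η} = Ind_{A·B^ψ}^𝒢(ψ₀η₀)` for some
homomorphism `ψ : A → ℂˣ` and some irreducible character `η` of the stabilizer `B^ψ`.
(2) Moreover, for representatives of distinct `B`-orbits (i.e. whenever `ψ, ψ'` are
either equal or lie in different `B`-orbits), one has `χ_{ψ,η} = χ_{ψ',η'}` if and only
if `ψ = ψ'` and `η = η'`. -/
theorem stmt_15 (𝒢 : Type) [Group 𝒢] [Fintype 𝒢] (A B : Subgroup 𝒢)
    (habel : ∀ a ∈ A, ∀ a' ∈ A, a * a' = a' * a) (hnorm : A.Normal)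
    (hint : A ⊓ B = ⊥) (hgen : ∀ g : 𝒢, ∃ a ∈ A, ∃ b ∈ B, g = a * b) :
    (∀ χ : 𝒢 → ℂ, (∃ V : FDRep ℂ 𝒢, Simple V ∧ χ = V.character) →
      ∃ (ψ : ↥A →* ℂˣ) (Bψ H : Subgroup 𝒢) (η : ↥Bψ → ℂ) (f : ↥H → ℂ),
        (∀ g : 𝒢, g ∈ Bψ ↔ g ∈ B ∧ ∀ (a : 𝒢) (ha : a ∈ A),
          ψ ⟨g⁻¹ * a * g, by simpa using hnorm.conj_mem a ha g⁻¹⟩ = ψ ⟨a, ha⟩) ∧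
        (∀ g : 𝒢, g ∈ H ↔ ∃ a ∈ A, ∃ b ∈ Bψ, g = a * b) ∧
        (∃ W : FDRep ℂ ↥Bψ, Simple W ∧ η = W.character) ∧
        (∀ (a b : 𝒢) (ha : a ∈ A) (hb : b ∈ Bψ) (hab : a * b ∈ H),
          f ⟨a * b, hab⟩ = (ψ ⟨a, ha⟩ : ℂ) * η ⟨b, hb⟩) ∧
        χ = fun g : 𝒢 => (Nat.card ↥H : ℂ)⁻¹ * ∑ x : 𝒢,
          if hx : x⁻¹ * g * x ∈ H then f ⟨x⁻¹ * g * x, hx⟩ else 0) ∧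
    (∀ (ψ ψ' : ↥A →* ℂˣ) (Bψ Bψ' H H' : Subgroup 𝒢)
        (η : ↥Bψ → ℂ) (η' : ↥Bψ' → ℂ) (f : ↥H → ℂ) (f' : ↥H' → ℂ),
      (∀ g : 𝒢, g ∈ Bψ ↔ g ∈ B ∧ ∀ (a : 𝒢) (ha : a ∈ A),
        ψ ⟨g⁻¹ * a * g, by simpa using hnorm.conj_mem a ha g⁻¹⟩ = ψ ⟨a, ha⟩) →
      (∀ g : 𝒢, g ∈ Bψ' ↔ g ∈ B ∧ ∀ (a : 𝒢) (ha : a ∈ A),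
        ψ' ⟨g⁻¹ * a * g, by simpa using hnorm.conj_mem a ha g⁻¹⟩ = ψ' ⟨a, ha⟩) →
      (∀ g : 𝒢, g ∈ H ↔ ∃ a ∈ A, ∃ b ∈ Bψ, g = a * b) →
      (∀ g : 𝒢, g ∈ H' ↔ ∃ a ∈ A, ∃ b ∈ Bψ', g = a * b) →
      (∃ W : FDRep ℂ ↥Bψ, Simple W ∧ η = W.character) →
      (∃ W : FDRep ℂ ↥Bψ', Simple W ∧ η' = W.character) →
      (∀ (a b : 𝒢) (ha : a ∈ A) (hb : b ∈ Bψ) (hab : a * b ∈ H),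
        f ⟨a * b, hab⟩ = (ψ ⟨a, ha⟩ : ℂ) * η ⟨b, hb⟩) →
      (∀ (a b : 𝒢) (ha : a ∈ A) (hb : b ∈ Bψ') (hab : a * b ∈ H'),
        f' ⟨a * b, hab⟩ = (ψ' ⟨a, ha⟩ : ℂ) * η' ⟨b, hb⟩) →
      -- `ψ` and `ψ'` are representatives: if they lie in the same `B`-orbit they are equal
      ((∃ b ∈ B, ∀ (a : 𝒢) (ha : a ∈ A),
        ψ' ⟨a, ha⟩ = ψ ⟨b⁻¹ * a * b, by simpa using hnorm.conj_mem a ha b⁻¹⟩) → ψ = ψ') →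
      ((fun g : 𝒢 => (Nat.card ↥H : ℂ)⁻¹ * ∑ x : 𝒢,
          if hx : x⁻¹ * g * x ∈ H then f ⟨x⁻¹ * g * x, hx⟩ else 0) =
        (fun g : 𝒢 => (Nat.card ↥H' : ℂ)⁻¹ * ∑ x : 𝒢,
          if hx : x⁻¹ * g * x ∈ H' then f' ⟨x⁻¹ * g * x, hx⟩ else 0) ↔
        (ψ = ψ' ∧ HEq η η'))) := by
  have hN := hnorm
  have hc : ∀ x : 𝒢, ∀ a ∈ A, x⁻¹ * a * x ∈ A := fun x a ha => by
    simpa using hnorm.conj_mem a ha x⁻¹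
  constructor
  · rintro χ ⟨V, hV, rfl⟩
    have hsim := S15.simple_sub V
    have : Nontrivial V := by
      by_contra h
      rw [not_nontrivial_iff_subsingleton] at h
      exact S15.char_one_ne V hV (by rw [FDRep.char_one, Module.finrank_zero_of_subsingleton]; simp)
    obtain ⟨ψ, hψ⟩ := S15.exists_PP (A := A) V.ρ habel
    obtain ⟨Bψ, H, S⟩ := S15.exists_setup B habel hint hgen ψ
    have hirr := S15.WW_irr V.ρ S hψ hsim
    refine ⟨ψ, Bψ, H, (FDRep.of (S15.WW V.ρ S)).character,
      fun h => LinearMap.trace ℂ V (S15.PP V.ρ ψ * V.ρ (h : 𝒢)), fun g => ?_, S.hH,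
      ⟨FDRep.of (S15.WW V.ρ S), S15.of_simple _, rfl⟩, ?_, ?_⟩
    · rw [S.hB, S15.tw_iff A g ψ ψ (hc g)]
    · intro a b ha hb hab
      have h1 := S15.PP_mul_rho V.ρ ψ ⟨a, ha⟩
      change S15.PP V.ρ ψ * V.ρ a = _ at h1
      rw [← S15.WW_trace V.ρ S ⟨b, hb⟩]
      change LinearMap.trace ℂ V (S15.PP V.ρ ψ * V.ρ (a * b)) = _
      rw [map_mul V.ρ, ← mul_assoc, h1, smul_mul_assoc, map_smul, smul_eq_mul]
    · funext g
      exact S15.char_eq V.ρ S hψ hsim g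
  · rintro ψ ψ' Bψ Bψ' H H' η η' f f' hB hB' hH hH' ⟨W, hW, rfl⟩ ⟨W', hW', rfl⟩ hf hf' horb
    have S : S15.Setup A B Bψ H ψ := ⟨habel, hint, hgen, fun g => by
      rw [hB, S15.tw_iff A g ψ ψ (hc g)], hH⟩
    have S' : S15.Setup A B Bψ' H' ψ' := ⟨habel, hint, hgen, fun g => by
      rw [hB', S15.tw_iff A g ψ' ψ' (hc g)], hH'⟩
    refine S15.inj S S' W W' hW' f f' hf hf' ?_
    rintro ⟨b, hb, h⟩
    refine horb ⟨b, hb, fun a ha => ?_⟩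
    exact ((S15.tw_iff A b ψ ψ' (hc b)).1 h.symm a ha).symm
end

section
/- The set H = Hei₂ is a subgroup of GL_N(𝔽_q), the sets A and B are subgroups of H, A is abelian and normal in H, A ∩ B = {1}, and AB = H; that is, H is the internal semidirect product A ⋊ B. -/
open Matrix CategoryTheory

/-- The symmetric bilinear form `β(u,v) = Σ_{i=1}^N u_i v_{N+1−i}` on `𝔽ᴺ`
(in 0-based indexing, `β(u,v) = Σ_i u_i v_{N-1-i}`). -/
def bform (N : ℕ) (𝔽 : Type) [Field 𝔽] (u v : Fin N → 𝔽) : 𝔽 :=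
  ∑ i : Fin N, u i * v (Fin.rev i)

/-- Membership in the orthogonal 2-layered Heisenberg group `Hei₂`: `g` is upper
unitriangular, preserves the form `β`, and `g_{ij} = 0` for every pair `i < j` with
`i ∉ {1,2}` and `j ∉ {N−1,N}` (1-based; in the 0-based indexing used here,
`i ∉ {0,1}` and `j ∉ {N−2,N−1}`). -/
def heiMem (N : ℕ) (𝔽 : Type) [Field 𝔽] (g : GL (Fin N) 𝔽) : Prop :=
  (∀ i : Fin N, (g : Matrix (Fin N) (Fin N) 𝔽) i i = 1) ∧
  (∀ i j : Fin N, j < i → (g : Matrix (Fin N) (Fin N) 𝔽) i j = 0) ∧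
  (∀ u v : Fin N → 𝔽,
    bform N 𝔽 ((g : Matrix (Fin N) (Fin N) 𝔽) *ᵥ u)
      ((g : Matrix (Fin N) (Fin N) 𝔽) *ᵥ v) = bform N 𝔽 u v) ∧
  (∀ i j : Fin N, i < j → (i : ℕ) ≠ 0 → (i : ℕ) ≠ 1 →
    (j : ℕ) ≠ N - 2 → (j : ℕ) ≠ N - 1 → (g : Matrix (Fin N) (Fin N) 𝔽) i j = 0)

/-- Membership in the subgroup `A ≤ Hei₂`: additionally `g_{ij} = 0` for all `i < j`
with `i ≠ 1` and `j ≠ N` (1-based; 0-based: `i ≠ 0`, `j ≠ N−1`). -/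
def aMem (N : ℕ) (𝔽 : Type) [Field 𝔽] (g : GL (Fin N) 𝔽) : Prop :=
  heiMem N 𝔽 g ∧
  ∀ i j : Fin N, i < j → (i : ℕ) ≠ 0 → (j : ℕ) ≠ N - 1 →
    (g : Matrix (Fin N) (Fin N) 𝔽) i j = 0

/-- Membership in the subgroup `B ≤ Hei₂`: additionally the first row and the last
column of `g` vanish off the diagonal. -/
def bMem (N : ℕ) (𝔽 : Type) [Field 𝔽] (g : GL (Fin N) 𝔽) : Prop :=
  heiMem N 𝔽 g ∧
  (∀ i j : Fin N, i < j → (i : ℕ) = 0 → (g : Matrix (Fin N) (Fin N) 𝔽) i j = 0) ∧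
  (∀ i j : Fin N, i < j → (j : ℕ) = N - 1 → (g : Matrix (Fin N) (Fin N) 𝔽) i j = 0)

section helpers
variable {N : ℕ} {𝔽 : Type} [Field 𝔽]

lemma bform_single_left (a : Fin N) (v : Fin N → 𝔽) :
    bform N 𝔽 (Pi.single a 1) v = v (Fin.rev a) := by
  unfold bform
  rw [Finset.sum_eq_single a]
  · simp
  · intro b _ hb; simp [hb]
  · simp

lemma bform_single_right (b : Fin N) (u : Fin N → 𝔽) :
    bform N 𝔽 u (Pi.single b 1) = u (Fin.rev b) := by
  unfold bform
  rw [Finset.sum_eq_single (Fin.rev b)]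
  · simp
  · intro c _ hc
    have : Fin.rev c ≠ b := by rintro rfl; simp at hc
    simp [this]
  · simp

/-- Entrywise description of the inverse of an element preserving the form. -/
lemma inv_entry {g : GL (Fin N) 𝔽}
    (hg : ∀ u v : Fin N → 𝔽,
      bform N 𝔽 ((g : Matrix (Fin N) (Fin N) 𝔽) *ᵥ u)
        ((g : Matrix (Fin N) (Fin N) 𝔽) *ᵥ v) = bform N 𝔽 u v) (i j : Fin N) :
    ((g⁻¹ : GL (Fin N) 𝔽) : Matrix (Fin N) (Fin N) 𝔽) i j
      = (g : Matrix (Fin N) (Fin N) 𝔽) (Fin.rev j) (Fin.rev i) := by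
  have h := hg (Pi.single (Fin.rev i) 1)
    (((g⁻¹ : GL (Fin N) 𝔽) : Matrix (Fin N) (Fin N) 𝔽) *ᵥ Pi.single j 1)
  rw [Matrix.mulVec_mulVec, ← Units.val_mul, mul_inv_cancel, Units.val_one, Matrix.one_mulVec,
    bform_single_right, bform_single_left] at h
  simpa using h.symm

lemma mul_diag {x y : Matrix (Fin N) (Fin N) 𝔽} (hx : ∀ i j, j < i → x i j = 0)
    (hy : ∀ i j, j < i → y i j = 0) (hx1 : ∀ i, x i i = 1) (hy1 : ∀ i, y i i = 1) (i : Fin N) :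
    (x * y) i i = 1 := by
  rw [Matrix.mul_apply, Finset.sum_eq_single i]
  · simp [hx1, hy1]
  · intro k _ hk
    rcases lt_or_gt_of_ne hk with h | h
    · simp [hx _ _ h]
    · simp [hy _ _ h]
  · simp

lemma mul_lower {x y : Matrix (Fin N) (Fin N) 𝔽} (hx : ∀ i j, j < i → x i j = 0)
    (hy : ∀ i j, j < i → y i j = 0) (i j : Fin N) (hij : j < i) :
    (x * y) i j = 0 := by
  rw [Matrix.mul_apply]
  apply Finset.sum_eq_zero
  intro k _
  rcases lt_or_ge k i with h | h
  · simp [hx _ _ h]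
  · simp [hy _ _ (lt_of_lt_of_le hij h)]

lemma mul_upper {x y : Matrix (Fin N) (Fin N) 𝔽} (hx : ∀ i j, j < i → x i j = 0)
    (hy : ∀ i j, j < i → y i j = 0) (i j : Fin N) (hxy : x i j = 0) (hyy : y i j = 0)
    (hm : ∀ k, i < k → k < j → x i k * y k j = 0) :
    (x * y) i j = 0 := by
  rw [Matrix.mul_apply]
  apply Finset.sum_eq_zero
  intro k _
  rcases lt_trichotomy k i with h | h | h
  · simp [hx _ _ h]
  · subst h; simp [hyy]
  rcases lt_trichotomy k j with h' | h' | h'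
  · exact hm k h h'
  · subst h'; simp [hxy]
  · simp [hy _ _ h']

lemma hei_one : heiMem N 𝔽 1 := by
  refine ⟨?_, ?_, ?_, ?_⟩
  · intro i; simp
  · intro i j h; simp [Matrix.one_apply, h.ne']
  · intro u v; simp
  · intro i j h _ _ _ _; simp [Matrix.one_apply, h.ne]

lemma hei_mul {g h : GL (Fin N) 𝔽} (hg : heiMem N 𝔽 g) (hh : heiMem N 𝔽 h) :
    heiMem N 𝔽 (g * h) := by
  obtain ⟨g1, g2, g3, g4⟩ := hg
  obtain ⟨h1, h2, h3, h4⟩ := hh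
  refine ⟨?_, ?_, ?_, ?_⟩
  · rw [Units.val_mul]; exact mul_diag g2 h2 g1 h1
  · rw [Units.val_mul]; exact mul_lower g2 h2
  · intro u v
    rw [Units.val_mul, ← Matrix.mulVec_mulVec, ← Matrix.mulVec_mulVec, g3, h3]
  · intro i j hij a b c d
    rw [Units.val_mul]
    refine mul_upper g2 h2 i j (g4 i j hij a b c d) (h4 i j hij a b c d) ?_
    intro k hk hk'
    rw [g4 i k hk a b (by omega) (by omega), zero_mul]

lemma hei_inv {g : GL (Fin N) 𝔽} (hg : heiMem N 𝔽 g) : heiMem N 𝔽 g⁻¹ := by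
  obtain ⟨g1, g2, g3, g4⟩ := hg
  refine ⟨?_, ?_, ?_, ?_⟩
  · intro i; rw [inv_entry g3]; exact g1 _
  · intro i j h; rw [inv_entry g3]; exact g2 _ _ (by simpa using h)
  · intro u v
    rw [← g3, Matrix.mulVec_mulVec, Matrix.mulVec_mulVec, ← Units.val_mul, mul_inv_cancel]
    simp
  · intro i j hij a b c d
    rw [inv_entry g3]
    apply g4 _ _ (by simpa using hij) <;> rw [Fin.val_rev] <;> omega

/-- `Hei₂` as a subgroup. -/
def heiSub (N : ℕ) (𝔽 : Type) [Field 𝔽] : Subgroup (GL (Fin N) 𝔽) where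
  carrier := {g | heiMem N 𝔽 g}
  one_mem' := hei_one
  mul_mem' := hei_mul
  inv_mem' := hei_inv

/-- `A` as a subgroup. -/
def aSub (N : ℕ) (𝔽 : Type) [Field 𝔽] : Subgroup (GL (Fin N) 𝔽) where
  carrier := {g | aMem N 𝔽 g}
  one_mem' := ⟨hei_one, fun i j h _ _ => by simp [Matrix.one_apply, h.ne]⟩
  mul_mem' := by
    rintro g h ⟨hg, ga⟩ ⟨hh, ha⟩
    refine ⟨hei_mul hg hh, ?_⟩
    intro i j hij a b
    rw [Units.val_mul]
    refine mul_upper hg.2.1 hh.2.1 i j (ga i j hij a b) (ha i j hij a b) ?_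
    intro k hk hk'
    rw [ga i k hk a (by omega), zero_mul]
  inv_mem' := by
    rintro g ⟨hg, ga⟩
    refine ⟨hei_inv hg, ?_⟩
    intro i j hij a b
    rw [inv_entry hg.2.2.1]
    apply ga _ _ (by simpa using hij) <;> rw [Fin.val_rev] <;> omega

/-- `B` as a subgroup. -/
def bSub (N : ℕ) (𝔽 : Type) [Field 𝔽] : Subgroup (GL (Fin N) 𝔽) where
  carrier := {g | bMem N 𝔽 g}
  one_mem' := ⟨hei_one, fun i j h _ => by simp [Matrix.one_apply, h.ne],
    fun i j h _ => by simp [Matrix.one_apply, h.ne]⟩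
  mul_mem' := by
    rintro g h ⟨hg, ga, gb⟩ ⟨hh, ha, hb⟩
    refine ⟨hei_mul hg hh, ?_, ?_⟩
    · intro i j hij a
      rw [Units.val_mul]
      refine mul_upper hg.2.1 hh.2.1 i j (ga i j hij a) (ha i j hij a) ?_
      intro k hk hk'
      rw [ga i k hk a, zero_mul]
    · intro i j hij a
      rw [Units.val_mul]
      refine mul_upper hg.2.1 hh.2.1 i j (gb i j hij a) (hb i j hij a) ?_
      intro k hk hk'
      rw [hb k j hk' a, mul_zero]
  inv_mem' := by
    rintro g ⟨hg, ga, gb⟩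
    refine ⟨hei_inv hg, ?_, ?_⟩
    · intro i j hij a
      rw [inv_entry hg.2.2.1]
      apply gb _ _ (by simpa using hij); rw [Fin.val_rev]; omega
    · intro i j hij a
      rw [inv_entry hg.2.2.1]
      apply ga _ _ (by simpa using hij); rw [Fin.val_rev]; omega

/-- In `A`, the last column is minus the reversed first row. -/
lemma a_col {g : GL (Fin N) 𝔽} (hg : aMem N 𝔽 g) (z k : Fin N) (hz : (z : ℕ) = 0)
    (hk0 : (k : ℕ) ≠ 0) (hk1 : (k : ℕ) ≠ N - 1) :
    (g : Matrix (Fin N) (Fin N) 𝔽) k (Fin.rev z)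
      = - (g : Matrix (Fin N) (Fin N) 𝔽) z (Fin.rev k) := by
  obtain ⟨⟨g1, g2, g3, g4⟩, ga⟩ := hg
  have e : ((g * g⁻¹ : GL (Fin N) 𝔽) : Matrix (Fin N) (Fin N) 𝔽) k (Fin.rev z) = 0 := by
    rw [mul_inv_cancel, Units.val_one, Matrix.one_apply_ne]
    intro h
    have := congrArg Fin.val h
    rw [Fin.val_rev] at this; omega
  have hne : k ≠ Fin.rev z := by
    intro h
    have := congrArg Fin.val h
    rw [Fin.val_rev] at this; omega
  rw [Units.val_mul, Matrix.mul_apply, Fintype.sum_eq_add k (Fin.rev z) hne] at e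
  · rw [inv_entry g3, inv_entry g3, g1, g1, Fin.rev_rev] at e
    linear_combination e
  · rintro x ⟨hx, hx'⟩
    rcases lt_or_gt_of_ne hx with h | h
    · rw [g2 _ _ h, zero_mul]
    · rw [ga _ _ h hk0, zero_mul]
      intro h'
      apply hx'
      ext
      rw [Fin.val_rev]; omega

lemma a_comm {g h : GL (Fin N) 𝔽} (hg : aMem N 𝔽 g) (hh : aMem N 𝔽 h) : g * h = h * g := by
  have key : ∀ {g h : GL (Fin N) 𝔽}, aMem N 𝔽 g → aMem N 𝔽 h → ∀ i j : Fin N, i < j →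
      ¬ ((i : ℕ) = 0 ∧ (j : ℕ) = N - 1) →
      (g * h : Matrix (Fin N) (Fin N) 𝔽) i j = (g : Matrix (Fin N) (Fin N) 𝔽) i j
        + (h : Matrix (Fin N) (Fin N) 𝔽) i j := by
    rintro g h ⟨⟨g1, g2, g3, g4⟩, ga⟩ ⟨⟨h1, h2, h3, h4⟩, ha⟩ i j hij hn
    rw [Matrix.mul_apply, Fintype.sum_eq_add i j hij.ne]
    · rw [g1, h1]; ring
    · rintro k ⟨hk, hk'⟩
      rcases lt_or_gt_of_ne hk with q | q
      · rw [g2 _ _ q, zero_mul]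
      rcases lt_or_gt_of_ne hk' with q' | q'
      · by_cases hi : (i : ℕ) = 0
        · rw [ha k j q' (by omega) (by omega), mul_zero]
        · rw [ga i k q hi (by omega), zero_mul]
      · rw [h2 _ _ q', mul_zero]
  ext i j
  rw [Units.val_mul, Units.val_mul]
  rcases lt_trichotomy i j with hij | hij | hij
  · by_cases hn : (i : ℕ) = 0 ∧ (j : ℕ) = N - 1
    · obtain ⟨hi, hj⟩ := hn
      have hjr : j = Fin.rev i := by ext; rw [Fin.val_rev]; omega
      subst hjr
      rw [Matrix.mul_apply, Matrix.mul_apply]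
      rw [← Equiv.sum_comp Fin.revPerm (fun k => (h : Matrix (Fin N) (Fin N) 𝔽) i k * _)]
      -- split off the extremal terms
      have hne : i ≠ Fin.rev i := hij.ne
      rw [← Finset.sum_erase_add _ _ (Finset.mem_univ i),
        ← Finset.sum_erase_add _ _ (Finset.mem_erase.2 ⟨hne.symm, Finset.mem_univ (Fin.rev i)⟩)]
      conv_rhs => rw [← Finset.sum_erase_add _ _ (Finset.mem_univ i),
        ← Finset.sum_erase_add _ _ (Finset.mem_erase.2 ⟨hne.symm, Finset.mem_univ (Fin.rev i)⟩)]
      have hs : ∀ k ∈ (Finset.univ.erase i).erase (Fin.rev i),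
          (g : Matrix (Fin N) (Fin N) 𝔽) i k * (h : Matrix (Fin N) (Fin N) 𝔽) k (Fin.rev i)
          = (h : Matrix (Fin N) (Fin N) 𝔽) i (Fin.revPerm k)
            * (g : Matrix (Fin N) (Fin N) 𝔽) (Fin.revPerm k) (Fin.rev i) := by
        intro k hk
        simp only [Finset.mem_erase, Finset.mem_univ, and_true] at hk
        obtain ⟨p1, p2⟩ := hk
        have q1 : (k : ℕ) ≠ N - 1 := by
          intro h'; apply p1; ext; omega
        have q2 : (k : ℕ) ≠ 0 := by
          intro h'; apply p2; ext; omega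
        rw [Fin.revPerm_apply, a_col hh i k hi q2 q1,
          a_col hg i (Fin.rev k) hi (by rw [Fin.val_rev]; omega) (by rw [Fin.val_rev]; omega),
          Fin.rev_rev]
        ring
      rw [Finset.sum_congr rfl hs]
      simp only [Fin.revPerm_apply, Fin.rev_rev, hg.1.1, hh.1.1]
      ring
    · rw [key hg hh i j hij hn, key hh hg i j hij hn, add_comm]
  · subst hij
    rw [mul_diag hg.1.2.1 hh.1.2.1 hg.1.1 hh.1.1, mul_diag hh.1.2.1 hg.1.2.1 hh.1.1 hg.1.1]
  · rw [mul_lower hg.1.2.1 hh.1.2.1 i j hij, mul_lower hh.1.2.1 hg.1.2.1 i j hij]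

lemma a_normal {h a : GL (Fin N) 𝔽} (hh : heiMem N 𝔽 h) (ha : aMem N 𝔽 a) :
    aMem N 𝔽 (h * a * h⁻¹) := by
  refine ⟨hei_mul (hei_mul hh ha.1) (hei_inv hh), ?_⟩
  intro i j hij hi hj
  have hi' := hei_inv hh
  have e : ((h * h⁻¹ : GL (Fin N) 𝔽) : Matrix (Fin N) (Fin N) 𝔽) i j = 0 := by
    rw [mul_inv_cancel, Units.val_one, Matrix.one_apply_ne hij.ne]
  rw [← e, Units.val_mul, Units.val_mul h h⁻¹, Matrix.mul_apply, Matrix.mul_apply]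
  apply Finset.sum_congr rfl
  intro k _
  by_cases hk : (k : ℕ) = N - 1
  · rw [hi'.2.1 k j (by rw [Fin.lt_def]; omega)]; simp
  · congr 1
    rw [Units.val_mul, Matrix.mul_apply, Finset.sum_eq_single k]
    · rw [ha.1.1, mul_one]
    · intro l _ hl
      rcases lt_or_gt_of_ne hl with q | q
      · by_cases hl0 : (l : ℕ) = 0
        · rw [hh.2.1 i l (by rw [Fin.lt_def]; omega), zero_mul]
        · rw [ha.2 l k q hl0 hk, mul_zero]
      · rw [ha.1.2.1 _ _ q, mul_zero]
    · simp

/-- Entrywise criterion for preserving the form. -/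
lemma form_of_entries {M : Matrix (Fin N) (Fin N) 𝔽}
    (hM : ∀ a b, ∑ k, M k a * M (Fin.rev k) b = if b = Fin.rev a then 1 else 0)
    (u v : Fin N → 𝔽) : bform N 𝔽 (M *ᵥ u) (M *ᵥ v) = bform N 𝔽 u v := by
  have : bform N 𝔽 (M *ᵥ u) (M *ᵥ v)
      = ∑ a, ∑ b, u a * v b * ∑ k, M k a * M (Fin.rev k) b := by
    unfold bform
    simp only [Matrix.mulVec, dotProduct, Finset.sum_mul_sum]
    simp only [Finset.mul_sum]
    rw [Finset.sum_comm]
    apply Finset.sum_congr rfl; intro a _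
    rw [Finset.sum_comm]
    apply Finset.sum_congr rfl; intro b _
    apply Finset.sum_congr rfl; intro k _
    ring
  rw [this]
  simp [hM, bform]

lemma entries_of_form {M : Matrix (Fin N) (Fin N) 𝔽}
    (hM : ∀ u v, bform N 𝔽 (M *ᵥ u) (M *ᵥ v) = bform N 𝔽 u v) (a b : Fin N) :
    ∑ k, M k a * M (Fin.rev k) b = if b = Fin.rev a then 1 else 0 := by
  have := hM (Pi.single a 1) (Pi.single b 1)
  rw [bform_single_left] at this
  simpa [bform, Pi.single_apply, eq_comm] using this

/-- The middle block of a matrix, extended by the identity. -/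
def midBlock (M : Matrix (Fin N) (Fin N) 𝔽) : Matrix (Fin N) (Fin N) 𝔽 := fun i j =>
  if (i : ℕ) = 0 ∨ (j : ℕ) = N - 1 then (if i = j then 1 else 0) else M i j

lemma exists_b (hN : 2 ≤ N) {h : GL (Fin N) 𝔽} (hh : heiMem N 𝔽 h) :
    ∃ b : GL (Fin N) 𝔽, bMem N 𝔽 b ∧ ∀ i j : Fin N, (i : ℕ) ≠ 0 → (j : ℕ) ≠ N - 1 →
      (b : Matrix (Fin N) (Fin N) 𝔽) i j = (h : Matrix (Fin N) (Fin N) 𝔽) i j := by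
  obtain ⟨h1, h2, h3, h4⟩ := hh
  set X := (h : Matrix (Fin N) (Fin N) 𝔽) with hX
  have d : ∀ i, midBlock X i i = 1 := by
    intro i; simp [midBlock, h1]
  have l : ∀ i j, j < i → midBlock X i j = 0 := by
    intro i j hij; unfold midBlock
    rw [h2 _ _ hij, if_neg hij.ne']; simp
  have r0 : ∀ i j : Fin N, (i : ℕ) = 0 → i ≠ j → midBlock X i j = 0 := by
    intro i j hi hij; simp [midBlock, hi, hij]
  have cN : ∀ i j : Fin N, (j : ℕ) = N - 1 → i ≠ j → midBlock X i j = 0 := by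
    intro i j hi hij; simp [midBlock, hi, hij]
  have c0 : ∀ i j : Fin N, (j : ℕ) = 0 → i ≠ j → midBlock X i j = 0 := by
    intro i j hi hij; apply l; rw [Fin.lt_def]
    have : (i : ℕ) ≠ j := fun h => hij (Fin.ext h)
    omega
  have rN : ∀ i j : Fin N, (i : ℕ) = N - 1 → i ≠ j → midBlock X i j = 0 := by
    intro i j hi hij; apply l; rw [Fin.lt_def]
    have : (i : ℕ) ≠ j := fun h => hij (Fin.ext h)
    omega
  have m : ∀ i j : Fin N, (i : ℕ) ≠ 0 → (j : ℕ) ≠ N - 1 → midBlock X i j = X i j := by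
    intro i j hi hj; simp [midBlock, hi, hj]
  have det : (midBlock X).det = 1 := by
    rw [Matrix.det_of_upperTriangular]
    · simp [d]
    · intro i j hij; exact l i j hij
  have unit : IsUnit (midBlock X).det := by rw [det]; exact isUnit_one
  have ent : ∀ a b, ∑ k, midBlock X k a * midBlock X (Fin.rev k) b
      = if b = Fin.rev a then 1 else 0 := by
    intro a b
    by_cases ha : (a : ℕ) = 0 ∨ (a : ℕ) = N - 1
    · rw [Finset.sum_eq_single a]
      · rw [d, one_mul]
        split_ifs with hb
        · rw [hb, d]
        · rcases ha with ha | ha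
          · exact rN _ _ (by rw [Fin.val_rev]; omega) (Ne.symm hb)
          · exact r0 _ _ (by rw [Fin.val_rev]; omega) (Ne.symm hb)
      · intro k _ hk
        rcases ha with ha | ha
        · rw [c0 _ _ ha hk, zero_mul]
        · rw [cN _ _ ha hk, zero_mul]
      · simp
    by_cases hb : (b : ℕ) = 0 ∨ (b : ℕ) = N - 1
    · rw [Finset.sum_eq_single (Fin.rev b)]
      · rw [Fin.rev_rev, d, mul_one]
        split_ifs with hb'
        · rw [hb', Fin.rev_rev, d]
        · have hne : Fin.rev b ≠ a := by rintro rfl; simp at hb'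
          rcases hb with hb | hb
          · exact rN _ _ (by rw [Fin.val_rev]; omega) hne
          · exact r0 _ _ (by rw [Fin.val_rev]; omega) hne
      · intro k _ hk
        have hne : Fin.rev k ≠ b := by rintro rfl; simp at hk
        rcases hb with hb | hb
        · rw [c0 _ _ hb hne, mul_zero]
        · rw [cN _ _ hb hne, mul_zero]
      · simp
    rw [← entries_of_form h3 a b]
    push Not at ha hb
    apply Finset.sum_congr rfl
    intro k _
    by_cases hk : (k : ℕ) = 0
    · rw [r0 k a hk (fun e => ha.1 (e ▸ hk)), h2 (Fin.rev k) b
        (by rw [Fin.lt_def, Fin.val_rev]; omega)]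
      simp
    by_cases hk' : (k : ℕ) = N - 1
    · rw [rN k a hk' (fun e => ha.2 (e ▸ hk')), h2 k a (by rw [Fin.lt_def]; omega)]
      simp
    rw [m k a hk ha.2, m (Fin.rev k) b (by rw [Fin.val_rev]; omega) hb.2]
  have hval : ((Matrix.GeneralLinearGroup.mk'' (midBlock X) unit : GL (Fin N) 𝔽) :
      Matrix (Fin N) (Fin N) 𝔽) = midBlock X := rfl
  refine ⟨Matrix.GeneralLinearGroup.mk'' (midBlock X) unit, ⟨⟨?_, ?_, ?_, ?_⟩, ?_, ?_⟩, ?_⟩ <;>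
    rw [hval]
  · exact d
  · exact l
  · exact form_of_entries ent
  · intro i j hij a b c e
    rw [m i j a e]; exact h4 i j hij a b c e
  · intro i j hij hi; exact r0 i j hi hij.ne
  · intro i j hij hi; exact cN i j hi hij.ne
  · exact m

lemma ab_decomp (hN : 2 ≤ N) {h : GL (Fin N) 𝔽} (hh : heiMem N 𝔽 h) :
    ∃ a, aMem N 𝔽 a ∧ ∃ b, bMem N 𝔽 b ∧ h = a * b := by
  obtain ⟨b, hb, hm⟩ := exists_b hN hh
  refine ⟨h * b⁻¹, ⟨hei_mul hh (hei_inv hb.1), ?_⟩, b, hb, by simp⟩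
  intro i j hij hi hj
  have e : ((b * b⁻¹ : GL (Fin N) 𝔽) : Matrix (Fin N) (Fin N) 𝔽) i j = 0 := by
    rw [mul_inv_cancel, Units.val_one, Matrix.one_apply_ne hij.ne]
  rw [← e, Units.val_mul, Units.val_mul, Matrix.mul_apply, Matrix.mul_apply]
  apply Finset.sum_congr rfl
  intro k _
  by_cases hk : (k : ℕ) = N - 1
  · rw [(hei_inv hb.1).2.1 k j (by rw [Fin.lt_def]; omega)]; simp
  · rw [hm i k hi hk]

lemma ab_inter {g : GL (Fin N) 𝔽} (ha : aMem N 𝔽 g) (hb : bMem N 𝔽 g) : g = 1 := by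
  ext i j
  rw [Units.val_one]
  rcases lt_trichotomy i j with h | h | h
  · rw [Matrix.one_apply_ne h.ne]
    by_cases hi : (i : ℕ) = 0
    · exact hb.2.1 i j h hi
    by_cases hj : (j : ℕ) = N - 1
    · exact hb.2.2 i j h hj
    exact ha.2 i j h hi hj
  · subst h; rw [ha.1.1, Matrix.one_apply_eq]
  · rw [ha.1.2.1 i j h, Matrix.one_apply_ne h.ne']

end helpers

/-- The set `H = Hei₂` is a subgroup of `GL_N(𝔽_q)`, the sets `A` and `B` are subgroups
of `H`, `A` is abelian and normal in `H`, `A ∩ B = {1}`, and `AB = H`; that is, `H` is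
the internal semidirect product `A ⋊ B`.  Here `N = 2n+3` (type `B_{n+1}`) or
`N = 2n+2` (type `D_{n+1}`), `q = p^k` with `p > 3` prime, and `n ≥ 2`. -/
theorem stmt_16 (p q k n N : ℕ) (hp : p.Prime) (hp3 : 3 < p) (hk : 0 < k) (hq : q = p ^ k)
    (hn : 2 ≤ n) (hN : N = 2 * n + 3 ∨ N = 2 * n + 2)
    (𝔽 : Type) [Field 𝔽] [Fintype 𝔽] (hcard : Fintype.card 𝔽 = q) :
    ∃ H A B : Subgroup (GL (Fin N) 𝔽),
      (∀ g : GL (Fin N) 𝔽, g ∈ H ↔ heiMem N 𝔽 g) ∧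
      (∀ g : GL (Fin N) 𝔽, g ∈ A ↔ aMem N 𝔽 g) ∧
      (∀ g : GL (Fin N) 𝔽, g ∈ B ↔ bMem N 𝔽 g) ∧
      A ≤ H ∧ B ≤ H ∧
      (∀ a ∈ A, ∀ a' ∈ A, a * a' = a' * a) ∧
      (∀ h ∈ H, ∀ a ∈ A, h * a * h⁻¹ ∈ A) ∧
      A ⊓ B = ⊥ ∧
      (∀ h ∈ H, ∃ a ∈ A, ∃ b ∈ B, h = a * b) := by
  refine ⟨heiSub N 𝔽, aSub N 𝔽, bSub N 𝔽, fun g => Iff.rfl, fun g => Iff.rfl, fun g => Iff.rfl,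
    fun g hg => hg.1, fun g hg => hg.1, fun a ha a' ha' => a_comm ha ha',
    fun h hh a ha => a_normal hh ha, ?_, fun h hh => ab_decomp (by omega) hh⟩
  rw [eq_bot_iff]
  rintro g ⟨ha, hb⟩
  exact ab_inter ha hb
end
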